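/- arXiv:2412.19783 — 2 statements merged into one kernel-verified Lean document; each statement's English description precedes it below -/
import Mathlib

section
/- The parking function sum enumerator and the labeled tree inversion enumerator satisfy P_n(x) = x^{C(n+1,2)} · I_{n+1}(1/x), i.e., Σ_{π ∈ PF_n} x^{sum(π)} = x^{n(n+1)/2} Σ_{T ∈ LT_{n+1}} x^{−inv(T)}. -/
/-- A parking function of length `n`: a sequence of positive integers whose
nondecreasing rearrangement `b` satisfies `b i ≤ i` (1-indexed). -/
def IsParkingFunction {n : ℕ} (a : Fin n → ℕ) : Prop :=
  (∀ i, 1 ≤ a i) ∧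
    ∃ σ : Equiv.Perm (Fin n), Monotone (a ∘ σ) ∧ ∀ i : Fin n, a (σ i) ≤ (i : ℕ) + 1

/-- The number of inversions of a labeled tree on vertex set `{0, 1, ..., n}`:
pairs `(i, j)` with `0 < i < j` such that `j` lies on the (unique) path from `i` to `0`. -/
noncomputable def treeInv {n : ℕ} (T : SimpleGraph (Fin (n + 1))) : ℕ :=
  Nat.card {p : Fin (n + 1) × Fin (n + 1) //
    0 < p.1 ∧ p.1 < p.2 ∧ ∀ w : T.Walk p.1 0, w.IsPath → p.2 ∈ w.support}

open scoped Classical in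
/-- The inversion enumerator `I_{n+1}(y) = Σ_{T ∈ LT_{n+1}} y^{inv T}` of labeled trees
on the vertex set `{0, 1, ..., n}`. -/
noncomputable def invPoly (n : ℕ) : Polynomial ℤ :=
  ∑ᶠ T : {G : SimpleGraph (Fin (n + 1)) // G.IsTree}, (Polynomial.X : Polynomial ℤ) ^ treeInv T.1

open Finset Relation

namespace ParkingTree

lemma sum_eq_sum_filter_of_existsUnique {α β R : Type*} [AddCommMonoid R] (s : Finset α)
    (t : Finset β) (r : α → β → Prop) [∀ b, DecidablePred fun a => r a b]
    (h : ∀ a ∈ s, ∃! b, b ∈ t ∧ r a b) (f : α → R) :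
    ∑ a ∈ s, f a = ∑ b ∈ t, ∑ a ∈ s with r a b, f a := by
  simp_rw [sum_filter]
  rw [sum_comm]
  refine sum_congr rfl fun a ha => ?_
  obtain ⟨b, ⟨hb, hr⟩, huniq⟩ := h a ha
  rw [sum_eq_single_of_mem b hb fun c hc hcb => if_neg fun hrc => hcb (huniq c ⟨hc, hrc⟩),
    if_pos hr]

lemma sum_pow_card_filter_lt {ι R : Type*} [LinearOrder ι] [CommSemiring R] (y : R)
    (s : Finset ι) : ∑ r ∈ s, y ^ #{b ∈ s | b < r} = ∑ k ∈ range #s, y ^ k := by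
  induction s using Finset.induction_on_max with
  | empty => simp
  | insert a s hs ih =>
    have ha : a ∉ s := fun h => lt_irrefl _ (hs a h)
    rw [sum_insert ha, card_insert_of_notMem ha, sum_range_succ, ← ih, add_comm]
    congr 1
    · refine sum_congr rfl fun r hr => ?_
      rw [filter_insert, if_neg (hs r hr).not_gt]
    · rw [filter_insert, if_neg (lt_irrefl a), filter_true_of_mem hs]

section Forest

variable {ι κ R : Type*}

/-- `a` is the parent of `b` in the forest with parent function `p`. -/
def IsParent (p : ι → Option ι) (a b : ι) : Prop := p b = some a

open scoped Classical in
/-- The number of inversions of the forest with parent function `p`: pairs `i < j` such that `j`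
is an ancestor of `i`. -/
noncomputable def forestInv [Fintype ι] [LinearOrder ι] (p : ι → Option ι) : ℕ :=
  ∑ i, #{j | i < j ∧ TransGen (IsParent p) j i}

open scoped Classical in
/-- The inversion enumerator of rooted forests on `ι`, evaluated at `y`. -/
noncomputable def forestEnum (ι : Type*) [Fintype ι] [LinearOrder ι] [CommSemiring R] (y : R) : R :=
  ∑ p : ι → Option ι with WellFounded (IsParent p), y ^ forestInv p

lemma isParent_congr (e : ι ≃ κ) (p : ι → Option ι) (a b : ι) :
    IsParent (e.arrowCongr e.optionCongr p) (e a) (e b) ↔ IsParent p a b := by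
  simp [IsParent, Equiv.arrowCongr]

lemma wellFounded_congr (e : ι ≃ κ) (p : ι → Option ι) :
    WellFounded (IsParent (e.arrowCongr e.optionCongr p)) ↔ WellFounded (IsParent p) :=
  let f : IsParent p ≃r IsParent (e.arrowCongr e.optionCongr p) :=
    ⟨e, fun {a b} => isParent_congr e p a b⟩
  ⟨fun h => f.toRelEmbedding.wellFounded h, fun h => f.symm.toRelEmbedding.wellFounded h⟩

lemma transGen_congr (e : ι ≃ κ) (p : ι → Option ι) (a b : ι) :
    TransGen (IsParent (e.arrowCongr e.optionCongr p)) (e a) (e b) ↔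
      TransGen (IsParent p) a b := by
  constructor
  · intro h
    have := TransGen.lift (p := IsParent p) e.symm (fun x y hxy => by
      rw [Function.onFun, ← isParent_congr e]; simpa using hxy) _ _ h
    simpa [Function.onFun] using this
  · exact TransGen.lift e (fun x y => (isParent_congr e p x y).2) a b

variable [Fintype ι] [LinearOrder ι] [Fintype κ] [LinearOrder κ]

lemma forestInv_congr (e : ι ≃o κ) (p : ι → Option ι) :
    forestInv (e.toEquiv.arrowCongr e.toEquiv.optionCongr p) = forestInv p := by
  classical
  unfold forestInv
  refine (Fintype.sum_equiv e.toEquiv _ _ fun i => ?_).symm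
  refine card_bij (fun j _ => e j) ?_ (fun _ _ _ _ h => e.injective h) ?_
  · intro j hj
    simp only [mem_filter, mem_univ, true_and] at hj ⊢
    exact ⟨e.lt_iff_lt.2 hj.1, (transGen_congr e.toEquiv p j i).2 hj.2⟩
  · intro k hk
    obtain ⟨j, rfl⟩ := e.surjective k
    simp only [mem_filter, mem_univ, true_and] at hk ⊢
    exact ⟨j, ⟨e.lt_iff_lt.1 hk.1, (transGen_congr e.toEquiv p j i).1 hk.2⟩, rfl⟩

lemma forestEnum_congr [CommSemiring R] (e : ι ≃o κ) (y : R) :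
    forestEnum ι y = forestEnum κ y := by
  classical
  unfold forestEnum
  refine sum_equiv (e.toEquiv.arrowCongr e.toEquiv.optionCongr) (fun p => ?_) fun p _ => ?_
  · simp only [mem_filter, mem_univ, true_and]
    exact (wellFounded_congr e.toEquiv p).symm
  · rw [forestInv_congr]

lemma forestEnum_eq_fin [CommSemiring R] {n : ℕ} (h : Fintype.card ι = n) (y : R) :
    forestEnum ι y = forestEnum (Fin n) y :=
  (forestEnum_congr (Fintype.orderIsoFinOfCardEq ι h) y).symm

end Forest

section Glue

variable {ι R : Type*} [LinearOrder ι] {D : Finset ι} {r : ι}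

/-- The forest obtained from a forest on `D` by adding a tree with root `r`, whose proper
descendants are the other elements outside `D` and form the second forest. -/
def glue (p₁ : {i // i ∈ D} → Option {i // i ∈ D})
    (p₂ : {i // i ∉ D ∧ i ≠ r} → Option {i // i ∉ D ∧ i ≠ r}) (i : ι) : Option ι :=
  if h : i ∈ D then (p₁ ⟨i, h⟩).map (↑)
  else if h' : i = r then none else some ((p₂ ⟨i, h, h'⟩).elim r (↑))

/-- The forest `p` consists of a forest on `D` and of a tree with root `r` on the complement. -/
def Splits (p : ι → Option ι) (D : Finset ι) (r : ι) : Prop :=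
  r ∉ D ∧ p r = none ∧ (∀ i ∈ D, ∀ k, p i = some k → k ∈ D) ∧
    ∀ i ∉ D, i ≠ r → ∃ k ∉ D, p i = some k

variable (p₁ : {i // i ∈ D} → Option {i // i ∈ D})
  (p₂ : {i // i ∉ D ∧ i ≠ r} → Option {i // i ∉ D ∧ i ≠ r})

lemma glue_mem (b : {i // i ∈ D}) : glue p₁ p₂ b = (p₁ b).map (↑) := by
  simp [glue, b.2]

lemma glue_root (hr : r ∉ D) : glue p₁ p₂ r = none := by
  simp [glue, hr]

lemma glue_notMem (b : {i // i ∉ D ∧ i ≠ r}) :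
    glue p₁ p₂ b = some ((p₂ b).elim r (↑)) := by
  simp [glue, b.2.1, b.2.2]

lemma isParent_glue_mem (a : ι) (b : {i // i ∈ D}) :
    IsParent (glue p₁ p₂) a b ↔ ∃ a' : {i // i ∈ D}, ↑a' = a ∧ IsParent p₁ a' b := by
  simp only [IsParent, glue_mem, Option.map_eq_some_iff]
  exact exists_congr fun _ => and_comm

lemma isParent_glue_notMem (a : ι) (b : {i // i ∉ D ∧ i ≠ r}) :
    IsParent (glue p₁ p₂) a b ↔ (a = r ∧ p₂ b = none) ∨
      ∃ a' : {i // i ∉ D ∧ i ≠ r}, ↑a' = a ∧ IsParent p₂ a' b := by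
  simp only [IsParent, glue_notMem, Option.some.injEq]
  rcases h : p₂ b with _ | c
  · simp [eq_comm]
  · simp only [Option.elim, Option.some.injEq, reduceCtorEq, and_false, false_or]
    constructor
    · rintro rfl
      exact ⟨c, rfl, rfl⟩
    · rintro ⟨a', rfl, rfl⟩
      rfl

lemma glue_splits (hr : r ∉ D) : Splits (glue p₁ p₂) D r := by
  refine ⟨hr, glue_root p₁ p₂ hr, fun i hi k hk => ?_, fun i hi hir => ?_⟩
  · obtain ⟨a, rfl, -⟩ := (isParent_glue_mem p₁ p₂ k ⟨i, hi⟩).1 hk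
    exact a.2
  · refine ⟨_, ?_, glue_notMem p₁ p₂ ⟨i, hi, hir⟩⟩
    rcases p₂ ⟨i, hi, hir⟩ with _ | c
    · exact hr
    · exact c.2.1

lemma wellFounded_glue_iff (hr : r ∉ D) :
    WellFounded (IsParent (glue p₁ p₂)) ↔
      WellFounded (IsParent p₁) ∧ WellFounded (IsParent p₂) := by
  constructor
  · intro h
    constructor
    · exact Subrelation.wf (fun {a b} hab => (isParent_glue_mem p₁ p₂ a b).2 ⟨a, rfl, hab⟩)
        (InvImage.wf Subtype.val h)
    · exact Subrelation.wf
        (fun {a b} hab => (isParent_glue_notMem p₁ p₂ a b).2 (Or.inr ⟨a, rfl, hab⟩))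
        (InvImage.wf Subtype.val h)
  · rintro ⟨h₁, h₂⟩
    have hroot : Acc (IsParent (glue p₁ p₂)) r :=
      ⟨_, fun a ha => by simp [IsParent, glue_root p₁ p₂ hr] at ha⟩
    have hmem (b : {i // i ∈ D}) : Acc (IsParent (glue p₁ p₂)) b := by
      induction b using h₁.induction with
      | _ b ih =>
        refine ⟨_, fun a ha => ?_⟩
        obtain ⟨a, rfl, hab⟩ := (isParent_glue_mem p₁ p₂ a b).1 ha
        exact ih a hab
    have hnotMem (b : {i // i ∉ D ∧ i ≠ r}) : Acc (IsParent (glue p₁ p₂)) b := by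
      induction b using h₂.induction with
      | _ b ih =>
        refine ⟨_, fun a ha => ?_⟩
        obtain ⟨rfl, -⟩ | ⟨a, rfl, hab⟩ := (isParent_glue_notMem p₁ p₂ a b).1 ha
        · exact hroot
        · exact ih a hab
    refine ⟨fun i => ?_⟩
    by_cases hi : i ∈ D
    · exact hmem ⟨i, hi⟩
    · by_cases hir : i = r
      · exact hir ▸ hroot
      · exact hnotMem ⟨i, hi, hir⟩

lemma transGen_glue_mem (h₁ : WellFounded (IsParent p₁)) (a : ι) (b : {i // i ∈ D}) :
    TransGen (IsParent (glue p₁ p₂)) a b ↔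
      ∃ a' : {i // i ∈ D}, ↑a' = a ∧ TransGen (IsParent p₁) a' b := by
  constructor
  · induction b using h₁.induction with
    | _ b ih =>
      intro h
      obtain ⟨c, hac, hc⟩ := TransGen.tail'_iff.1 h
      obtain ⟨c, rfl, hcb⟩ := (isParent_glue_mem p₁ p₂ c b).1 hc
      rcases reflTransGen_iff_eq_or_transGen.1 hac with hac | hac
      · exact ⟨c, hac, .single hcb⟩
      · obtain ⟨a', rfl, h'⟩ := ih c hcb hac
        exact ⟨a', rfl, h'.tail hcb⟩
  · rintro ⟨a, rfl, h⟩
    exact TransGen.lift Subtype.val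
      (fun x y hxy => (isParent_glue_mem p₁ p₂ x y).2 ⟨x, rfl, hxy⟩) _ _ h

lemma transGen_glue_root (hr : r ∉ D) (a : ι) : ¬ TransGen (IsParent (glue p₁ p₂)) a r := by
  intro h
  obtain ⟨c, -, hc⟩ := TransGen.tail'_iff.1 h
  simp [IsParent, glue_root p₁ p₂ hr] at hc

lemma transGen_glue_notMem (hr : r ∉ D) (h₂ : WellFounded (IsParent p₂)) (a : ι)
    (b : {i // i ∉ D ∧ i ≠ r}) :
    TransGen (IsParent (glue p₁ p₂)) a b ↔
      a = r ∨ ∃ a' : {i // i ∉ D ∧ i ≠ r}, ↑a' = a ∧ TransGen (IsParent p₂) a' b := by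
  constructor
  · induction b using h₂.induction with
    | _ b ih =>
      intro h
      obtain ⟨c, hac, hc⟩ := TransGen.tail'_iff.1 h
      obtain ⟨rfl, -⟩ | ⟨c, rfl, hcb⟩ := (isParent_glue_notMem p₁ p₂ c b).1 hc
      · rcases reflTransGen_iff_eq_or_transGen.1 hac with hac | hac
        · exact Or.inl hac.symm
        · exact absurd hac (transGen_glue_root p₁ p₂ hr a)
      · rcases reflTransGen_iff_eq_or_transGen.1 hac with hac | hac
        · exact Or.inr ⟨c, hac, .single hcb⟩
        · obtain h | ⟨a', rfl, h'⟩ := ih c hcb hac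
          · exact Or.inl h
          · exact Or.inr ⟨a', rfl, h'.tail hcb⟩
  · rintro (rfl | ⟨a, rfl, h⟩)
    · induction b using h₂.induction with
      | _ b ih =>
        rcases hb : p₂ b with _ | c
        · exact .single ((isParent_glue_notMem p₁ p₂ a b).2 (Or.inl ⟨rfl, hb⟩))
        · exact (ih c hb).tail ((isParent_glue_notMem p₁ p₂ c b).2 (Or.inr ⟨c, rfl, hb⟩))
    · exact TransGen.lift Subtype.val
        (fun x y hxy => (isParent_glue_notMem p₁ p₂ x y).2 (Or.inr ⟨x, rfl, hxy⟩)) _ _ h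

lemma glue_injective {q₁ : {i // i ∈ D} → Option {i // i ∈ D}}
    {q₂ : {i // i ∉ D ∧ i ≠ r} → Option {i // i ∉ D ∧ i ≠ r}}
    (h : glue p₁ p₂ = glue q₁ q₂) : p₁ = q₁ ∧ p₂ = q₂ := by
  constructor
  · funext b
    have := congrFun h b
    rw [glue_mem, glue_mem] at this
    exact Option.map_injective Subtype.val_injective this
  · funext b
    have := congrFun h b
    rw [glue_notMem, glue_notMem, Option.some.injEq] at this
    rcases hp : p₂ b with _ | c <;> rcases hq : q₂ b with _ | d <;> rw [hp, hq] at this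
    · exact absurd this.symm d.2.2
    · exact absurd this c.2.2
    · exact congrArg some (Subtype.ext this)

lemma Splits.exists_glue {p : ι → Option ι} (h : Splits p D r) :
    ∃ (p₁ : {i // i ∈ D} → Option {i // i ∈ D})
      (p₂ : {i // i ∉ D ∧ i ≠ r} → Option {i // i ∉ D ∧ i ≠ r}), glue p₁ p₂ = p := by
  obtain ⟨hr, hroot, hmem, hnotMem⟩ := h
  have h₁ (b : {i // i ∈ D}) : ∃ o : Option {i // i ∈ D}, o.map (↑) = p b := by
    rcases hb : p b with _ | k
    · exact ⟨none, rfl⟩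
    · exact ⟨some ⟨k, hmem b b.2 k hb⟩, rfl⟩
  have h₂ (b : {i // i ∉ D ∧ i ≠ r}) :
      ∃ o : Option {i // i ∉ D ∧ i ≠ r}, some (o.elim r (↑)) = p b := by
    obtain ⟨k, hk, hb⟩ := hnotMem b b.2.1 b.2.2
    by_cases hkr : k = r
    · exact ⟨none, by rw [hb, hkr]; rfl⟩
    · exact ⟨some ⟨k, hk, hkr⟩, hb.symm⟩
  choose p₁ hp₁ using h₁
  choose p₂ hp₂ using h₂
  refine ⟨p₁, p₂, funext fun i => ?_⟩
  by_cases hi : i ∈ D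
  · rw [← hp₁ ⟨i, hi⟩, ← glue_mem p₁ p₂]
  · by_cases hir : i = r
    · rw [hir, glue_root p₁ p₂ hr, hroot]
    · rw [← hp₂ ⟨i, hi, hir⟩, ← glue_notMem p₁ p₂]

lemma existsUnique_splits [Fintype ι] {p : ι → Option ι} (hp : WellFounded (IsParent p)) (m : ι) :
    ∃! z : Finset ι × ι, m ∉ z.1 ∧ Splits p z.1 z.2 := by
  classical
  have hdesc {D r} (h : Splits p D r) (i : ι) : i ∉ D ↔ ReflTransGen (IsParent p) r i := by
    constructor
    · induction i using hp.induction with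
      | _ i ih =>
        intro hi
        by_cases hir : i = r
        · rw [hir]
        · obtain ⟨k, hk, hik⟩ := h.2.2.2 i hi hir
          exact (ih k hik hk).tail hik
    · intro hi
      induction hi with
      | refl => exact h.1
      | tail _ hbc ih => exact fun hc => ih (h.2.2.1 _ hc _ hbc)
  have hup {D r} (h : Splits p D r) (a b : ι) (hab : ReflTransGen (IsParent p) a b) (hb : b ∉ D) :
      a ∉ D := by
    induction hab using ReflTransGen.head_induction_on with
    | refl => exact hb
    | @head a c hac _ ih =>
      by_cases hcr : c = r
      · rw [IsParent, hcr, h.2.1] at hac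
        cases hac
      · obtain ⟨k, hk, hck⟩ := h.2.2.2 c ih hcr
        cases hac.symm.trans hck
        exact hk
  have hex (b : ι) : ∃ r, ReflTransGen (IsParent p) r b ∧ p r = none := by
    induction b using hp.induction with
    | _ b ih =>
      rcases hb : p b with _ | c
      · exact ⟨b, .refl, hb⟩
      · obtain ⟨r, hr, hr'⟩ := ih c hb
        exact ⟨r, hr.tail hb, hr'⟩
  obtain ⟨r, hrm, hr⟩ := hex m
  have hsplit : Splits p ({i | ¬ ReflTransGen (IsParent p) r i} : Finset ι) r := by
    refine ⟨by simp [ReflTransGen.refl], hr, fun i hi k hk => ?_, fun i hi hir => ?_⟩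
    · simp only [mem_filter, mem_univ, true_and] at hi ⊢
      exact fun h => hi (h.tail hk)
    · simp only [mem_filter, mem_univ, true_and, not_not] at hi ⊢
      rcases reflTransGen_iff_eq_or_transGen.1 hi with h | h
      · exact absurd h hir
      · obtain ⟨c, hc, hci⟩ := TransGen.tail'_iff.1 h
        exact ⟨c, hc, hci⟩
  refine ⟨(_, r), ⟨by simpa using hrm, hsplit⟩, ?_⟩
  rintro ⟨D, s⟩ ⟨hm, h⟩
  have hrs : r = s := by
    by_contra hne
    obtain ⟨k, -, hk⟩ := h.2.2.2 r (hup h r m hrm hm) hne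
    rw [hr] at hk
    cases hk
  subst hrs
  refine Prod.ext (Finset.ext fun i => not_iff_not.1 ?_) rfl
  exact (hdesc h i).trans (hdesc hsplit i).symm

lemma forestInv_glue [Fintype ι] (hr : r ∉ D) (h₁ : WellFounded (IsParent p₁))
    (h₂ : WellFounded (IsParent p₂)) :
    forestInv (glue p₁ p₂) = #{b ∈ Dᶜ | b < r} + forestInv p₁ + forestInv p₂ := by
  classical
  have hsplit (f : ι → ℕ) : ∑ i, f i =
      (∑ i : {i // i ∈ D}, f i) + f r + ∑ i : {i // i ∉ D ∧ i ≠ r}, f i := by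
    have hD : r ∈ Dᶜ := by simpa using hr
    rw [← sum_add_sum_compl D, ← add_sum_erase _ _ hD, ← add_assoc]
    congr 1
    · rw [sum_coe_sort]
    · exact sum_subtype _ (fun i => by simp [and_comm]) _
  have hmem (i : {i // i ∈ D}) : #{j | ↑i < j ∧ TransGen (IsParent (glue p₁ p₂)) j i} =
      #{j | i < j ∧ TransGen (IsParent p₁) j i} := by
    rw [← card_map (Function.Embedding.subtype _)]
    congr 1
    ext j
    simp only [mem_filter, mem_univ, true_and, mem_map, transGen_glue_mem p₁ p₂ h₁,
      Function.Embedding.subtype_apply]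
    constructor
    · rintro ⟨hij, j, rfl, h⟩
      exact ⟨j, ⟨hij, h⟩, rfl⟩
    · rintro ⟨j, ⟨hij, h⟩, rfl⟩
      exact ⟨hij, j, rfl, h⟩
  have hnotMem (i : {i // i ∉ D ∧ i ≠ r}) :
      #{j | ↑i < j ∧ TransGen (IsParent (glue p₁ p₂)) j i} =
        (if ↑i ∉ D ∧ ↑i < r then 1 else 0) + #{j | i < j ∧ TransGen (IsParent p₂) j i} := by
    have hset : ({j | ↑i < j ∧ TransGen (IsParent (glue p₁ p₂)) j i} : Finset ι) =
        (if ↑i < r then {r} else ∅) ∪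
          ({j | i < j ∧ TransGen (IsParent p₂) j i} : Finset _).map
            (Function.Embedding.subtype _) := by
      ext j
      simp only [mem_filter, mem_univ, true_and, mem_map, transGen_glue_notMem p₁ p₂ hr h₂,
        Function.Embedding.subtype_apply, mem_union]
      constructor
      · rintro ⟨hij, rfl | ⟨j, rfl, h⟩⟩
        · simp [hij]
        · exact Or.inr ⟨j, ⟨hij, h⟩, rfl⟩
      · rintro (h | ⟨j, ⟨hij, h⟩, rfl⟩)
        · split_ifs at h with hir
          · rw [mem_singleton] at h
            exact ⟨h ▸ hir, Or.inl h⟩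
          · simp at h
        · exact ⟨hij, Or.inr ⟨j, rfl, h⟩⟩
    rw [hset, card_union_of_disjoint, card_map]
    · congr 1
      simp only [i.2.1, not_false_eq_true, true_and]
      split_ifs <;> rfl
    · rw [disjoint_right]
      intro j hj hj'
      obtain ⟨j, -, rfl⟩ := mem_map.1 hj
      split_ifs at hj'
      · exact j.2.2 (mem_singleton.1 hj')
      · simp at hj'
  have hlt : #{b ∈ Dᶜ | b < r} =
      ∑ i : {i // i ∉ D ∧ i ≠ r}, if ↑i ∉ D ∧ ↑i < r then 1 else 0 := by
    have := hsplit fun i => if i ∉ D ∧ i < r then 1 else 0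
    rw [← card_filter] at this
    simp only [lt_irrefl, and_false, if_false, add_zero, Subtype.prop, not_true_eq_false,
      false_and, sum_const_zero, zero_add] at this
    rw [← this]
    congr 1
    ext i
    simp
  have hroot : #{j | r < j ∧ TransGen (IsParent (glue p₁ p₂)) j r} = 0 := by
    simp [transGen_glue_root p₁ p₂ hr]
  rw [forestInv, hsplit, hroot, sum_congr rfl fun i _ => hmem i,
    sum_congr rfl fun i _ => hnotMem i, sum_add_distrib, ← hlt, forestInv, forestInv]
  ring

open scoped Classical in
lemma sum_splits [Fintype ι] [CommSemiring R] (hr : r ∉ D) (y : R) :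
    ∑ p : ι → Option ι with WellFounded (IsParent p) ∧ Splits p D r, y ^ forestInv p =
      y ^ #{b ∈ Dᶜ | b < r} *
        (forestEnum {i // i ∈ D} y * forestEnum {i // i ∉ D ∧ i ≠ r} y) := by
  rw [forestEnum, forestEnum, sum_mul_sum, ← sum_product', mul_sum]
  symm
  refine sum_bij (fun q _ => glue q.1 q.2) ?_ ?_ ?_ ?_
  · rintro ⟨p₁, p₂⟩ h
    simp only [mem_product, mem_filter, mem_univ, true_and] at h ⊢
    exact ⟨(wellFounded_glue_iff p₁ p₂ hr).2 h, glue_splits p₁ p₂ hr⟩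
  · rintro ⟨p₁, p₂⟩ - ⟨q₁, q₂⟩ - h
    exact Prod.ext_iff.2 (glue_injective p₁ p₂ h)
  · intro p hp
    simp only [mem_filter, mem_univ, true_and] at hp
    obtain ⟨p₁, p₂, rfl⟩ := hp.2.exists_glue
    exact ⟨(p₁, p₂), by simpa using (wellFounded_glue_iff p₁ p₂ hr).1 hp.1, rfl⟩
  · rintro ⟨p₁, p₂⟩ h
    simp only [mem_product, mem_filter, mem_univ, true_and] at h
    rw [forestInv_glue p₁ p₂ hr h.1 h.2, pow_add, pow_add, mul_assoc]

lemma forestEnum_succ [CommSemiring R] (n : ℕ) (y : R) :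
    forestEnum (Fin (n + 1)) y = ∑ i ∈ range (n + 1), n.choose i •
      ((∑ k ∈ range (i + 1), y ^ k) * (forestEnum (Fin (n - i)) y * forestEnum (Fin i) y)) := by
  classical
  have hunique (p : Fin (n + 1) → Option (Fin (n + 1)))
      (hp : p ∈ ({p | WellFounded (IsParent p)} : Finset _)) :
      ∃! z : Finset (Fin (n + 1)) × Fin (n + 1),
        z ∈ ((univ.erase 0).powerset ×ˢ univ) ∧ Splits p z.1 z.2 := by
    simpa [subset_erase] using existsUnique_splits (mem_filter.1 hp).2 0
  have hcard (D : Finset (Fin (n + 1))) (hD : D ∈ (univ.erase 0).powerset) :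
      #D ≤ n := by
    simpa using card_le_card (mem_powerset.1 hD)
  have hsum (D : Finset (Fin (n + 1))) (hD : D ∈ (univ.erase 0).powerset) :
      (∑ r, ∑ p : Fin (n + 1) → Option (Fin (n + 1)) with
        WellFounded (IsParent p) ∧ Splits p D r, y ^ forestInv p) =
      (∑ k ∈ range (n - #D + 1), y ^ k) *
        (forestEnum (Fin #D) y * forestEnum (Fin (n - #D)) y) := by
    have hzero (r : Fin (n + 1)) (hr : r ∈ D) :
        (∑ p : Fin (n + 1) → Option (Fin (n + 1)) with
          WellFounded (IsParent p) ∧ Splits p D r, y ^ forestInv p) = 0 := by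
      refine sum_eq_zero fun p hp => absurd hr (mem_filter.1 hp).2.2.1
    rw [← sum_add_sum_compl D, sum_eq_zero hzero, zero_add]
    have hD' : #Dᶜ = n - #D + 1 := by
      have := hcard D hD
      rw [card_compl, Fintype.card_fin]
      omega
    rw [← hD', ← sum_pow_card_filter_lt, sum_mul]
    refine sum_congr rfl fun r hr => ?_
    rw [sum_splits (mem_compl.1 hr), forestEnum_eq_fin (n := #D) (by simp),
      forestEnum_eq_fin (ι := {i // i ∉ D ∧ i ≠ r}) (n := n - #D)]
    rw [Fintype.card_subtype]
    have : ({i | i ∉ D ∧ i ≠ r} : Finset (Fin (n + 1))) = Dᶜ.erase r := by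
      ext i
      simp [and_comm]
    rw [this, card_erase_of_mem hr, hD', Nat.add_sub_cancel]
  rw [forestEnum, sum_eq_sum_filter_of_existsUnique _ _ _ hunique, sum_product]
  simp_rw [filter_filter]
  rw [sum_congr rfl hsum, sum_powerset_apply_card (f := fun j =>
    (∑ k ∈ range (n - j + 1), y ^ k) * (forestEnum (Fin j) y * forestEnum (Fin (n - j)) y))]
  simp only [mem_univ, card_erase_of_mem, card_univ, Fintype.card_fin, Nat.add_sub_cancel]
  rw [← sum_range_reflect]
  refine sum_congr rfl fun i hi => ?_
  have hi : i ≤ n := Nat.lt_succ_iff.1 (mem_range.1 hi)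
  rw [Nat.add_sub_cancel, Nat.choose_symm hi, Nat.sub_sub_self hi]

end Glue

section ParkingGlue

variable {κ : Type*} [DecidableEq κ]

/-- The parking function given by the preference of the car `none`, a parking function on `A` and
a shifted parking function on the complement of `A`. -/
def parkingGlue (A : Finset κ) (z : ℕ × ({i // i ∈ A} → ℕ) × ({i // i ∉ A} → ℕ)) :
    Option κ → ℕ
  | none => z.1
  | some i => if h : i ∈ A then z.2.1 ⟨i, h⟩ else z.2.2 ⟨i, h⟩ + (#A + 1)

lemma parkingGlue_mem (A : Finset κ) (z : ℕ × ({i // i ∈ A} → ℕ) × ({i // i ∉ A} → ℕ))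
    (i : {i // i ∈ A}) : parkingGlue A z (some i) = z.2.1 i := by
  simp [parkingGlue, i.2]

lemma parkingGlue_notMem (A : Finset κ) (z : ℕ × ({i // i ∈ A} → ℕ) × ({i // i ∉ A} → ℕ))
    (i : {i // i ∉ A}) : parkingGlue A z (some i) = z.2.2 i + (#A + 1) := by
  simp [parkingGlue, i.2]

end ParkingGlue

section Parking

variable {ι κ R : Type*} [Fintype ι] [Fintype κ]

/-- Parking functions with values starting from `0`: for all `k ≤ |ι|`, at least `k` of the values
are smaller than `k`. -/
def IsParking (c : ι → ℕ) : Prop := ∀ k ≤ Fintype.card ι, k ≤ #{i | c i < k}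

lemma IsParking.lt {c : ι → ℕ} (hc : IsParking c) (i : ι) : c i < Fintype.card ι := by
  have h : ({i | c i < Fintype.card ι} : Finset ι) = univ :=
    eq_univ_of_card _ (le_antisymm (card_le_univ _) (hc _ le_rfl))
  simpa using h.ge (mem_univ i)

open scoped Classical in
/-- The finite set of parking functions (with values starting from `0`) on `ι`. -/
noncomputable def parkingSet (ι : Type*) [Fintype ι] : Finset (ι → ℕ) :=
  {c ∈ Fintype.piFinset fun _ => range (Fintype.card ι) | IsParking c}

lemma mem_parkingSet {c : ι → ℕ} : c ∈ parkingSet ι ↔ IsParking c := by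
  simp only [parkingSet, mem_filter, Fintype.mem_piFinset, mem_range, and_iff_right_iff_imp]
  exact IsParking.lt

/-- The sum enumerator of parking functions (with values starting from `0`) on `ι`. -/
noncomputable def parkingEnum (ι : Type*) [Fintype ι] [CommSemiring R] (x : R) : R :=
  ∑ c ∈ parkingSet ι, x ^ ∑ i, c i

lemma isParking_comp_equiv (e : ι ≃ κ) (c : κ → ℕ) : IsParking (c ∘ e) ↔ IsParking c := by
  have (k : ℕ) : #{i | (c ∘ e) i < k} = #{i | c i < k} := by
    rw [card_filter, card_filter]
    exact Fintype.sum_equiv e _ _ fun _ => rfl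
  simp only [IsParking, this, Fintype.card_congr e]

lemma parkingEnum_congr [CommSemiring R] (e : ι ≃ κ) (x : R) :
    parkingEnum ι x = parkingEnum κ x := by
  refine (sum_bij (fun c _ => c ∘ e) ?_ ?_ ?_ ?_).symm
  · intro c hc
    exact mem_parkingSet.2 ((isParking_comp_equiv e c).2 (mem_parkingSet.1 hc))
  · intro c _ d _ h
    exact e.surjective.injective_comp_right h
  · intro c hc
    refine ⟨c ∘ e.symm, mem_parkingSet.2 ?_, ?_⟩
    · exact (isParking_comp_equiv e.symm c).2 (mem_parkingSet.1 hc)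
    · ext i
      simp
  · intro c _
    rw [← Fintype.sum_equiv e (c ∘ e) c fun _ => rfl]

lemma parkingEnum_eq_fin [CommSemiring R] {n : ℕ} (h : Fintype.card ι = n) (x : R) :
    parkingEnum ι x = parkingEnum (Fin n) x :=
  parkingEnum_congr (Fintype.equivFinOfCardEq h) x

lemma card_lt_option (c : Option κ → ℕ) (k : ℕ) :
    #{o | c o < k} = (if c none < k then 1 else 0) + #{i | c (some i) < k} := by
  simp only [card_filter, Fintype.sum_option]

variable [DecidableEq κ]

/-- The cars in `A` park in the first `#A` spots, the car `none` in a spot that is then left empty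
by the other cars. -/
def ParkingSplits (c : Option κ → ℕ) (A : Finset κ) : Prop :=
  c none ≤ #A ∧ IsParking (fun i : {i // i ∈ A} => c (some i)) ∧
    (∀ i ∉ A, #A < c (some i)) ∧ IsParking (fun i : {i // i ∉ A} => c (some i) - (#A + 1))

lemma sum_eq_sum_mem_add_sum_notMem (A : Finset κ) (f : κ → ℕ) :
    ∑ i, f i = ∑ i : {i // i ∈ A}, f i + ∑ i : {i // i ∉ A}, f i := by
  rw [← sum_add_sum_compl A, sum_coe_sort, sum_subtype Aᶜ (p := (· ∉ A)) (by simp)]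

lemma card_lt_some (c : κ → ℕ) (A : Finset κ) (k : ℕ) :
    #{i | c i < k} = #{i : {i // i ∈ A} | c i < k} + #{i : {i // i ∉ A} | c i < k} := by
  simp only [card_filter]
  exact sum_eq_sum_mem_add_sum_notMem A _

lemma card_subtype_notMem (A : Finset κ) :
    Fintype.card {i // i ∉ A} = Fintype.card κ - #A := by
  rw [Fintype.card_subtype_compl, Fintype.card_coe]

lemma ParkingSplits.isParking {c : Option κ → ℕ} {A : Finset κ} (h : ParkingSplits c A) :
    IsParking c := by
  obtain ⟨h₀, h₁, h₂, h₃⟩ := h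
  intro k hk
  rw [card_lt_option, card_lt_some _ A]
  rcases le_or_gt k #A with hkA | hkA
  · have := h₁ k (by simpa using hkA)
    beta_reduce at this
    omega
  · obtain ⟨l, rfl⟩ := Nat.exists_eq_add_of_lt hkA
    have hA : #{i : {i // i ∈ A} | c (some i) < #A + l + 1} = #A := by
      rw [filter_true_of_mem, card_univ, Fintype.card_coe]
      intro i _
      have := h₁.lt i
      rw [Fintype.card_coe] at this
      omega
    have hl := h₃ l (by
      rw [card_subtype_notMem]
      rw [Fintype.card_option] at hk
      omega)
    beta_reduce at hl
    have hle : #{i : {i // i ∉ A} | c (some i) - (#A + 1) < l} ≤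
        #{i : {i // i ∉ A} | c (some i) < #A + l + 1} := by
      refine card_le_card fun i hi => ?_
      simp only [mem_filter, mem_univ, true_and] at hi ⊢
      omega
    rw [hA, if_pos (by omega)]
    omega

lemma ParkingSplits.mem_iff {c : Option κ → ℕ} {A : Finset κ} (h : ParkingSplits c A) (i : κ) :
    i ∈ A ↔ c (some i) ≤ #A := by
  constructor
  · intro hi
    simpa using (h.2.1.lt ⟨i, hi⟩).le
  · intro hi
    by_contra hiA
    exact absurd hi (h.2.2.1 i hiA).not_ge

lemma ParkingSplits.card_le {c : Option κ → ℕ} {A B : Finset κ} (hA : ParkingSplits c A)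
    (hB : ParkingSplits c B) : #B ≤ #A := by
  by_contra! hlt
  have h := hB.2.1 (#A + 1) (by simpa using hlt)
  beta_reduce at h
  have hle : #{i : {i // i ∈ B} | c (some i) < #A + 1} ≤ #A := by
    rw [← card_map (Function.Embedding.subtype _)]
    refine card_le_card fun i hi => ?_
    obtain ⟨i, hiA, rfl⟩ := mem_map.1 hi
    exact (hA.mem_iff i).2 (Nat.lt_succ_iff.1 (mem_filter.1 hiA).2)
  omega

lemma IsParking.exists_parkingSplits {c : Option κ → ℕ} (hc : IsParking c) :
    ∃ A, ParkingSplits c A := by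
  have hex : ∃ k, #{i | c (some i) < k + 1} ≤ k := ⟨Fintype.card κ, card_le_univ _⟩
  obtain ⟨k, hk, hmin⟩ : ∃ k, #{i | c (some i) < k + 1} ≤ k ∧
      ∀ j ≤ k, j ≤ #{i | c (some i) < j} := by
    refine ⟨Nat.find hex, Nat.find_spec hex, fun j hj => ?_⟩
    rcases j with _ | j
    · exact Nat.zero_le _
    · have := Nat.find_min hex hj
      omega
  have hsub : ({i | c (some i) < k} : Finset κ) ⊆
      ({i | c (some i) < k + 1} : Finset κ) := by
    intro i hi
    simp only [mem_filter, mem_univ, true_and] at hi ⊢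
    omega
  have heq := eq_of_subset_of_card_le hsub (hk.trans (hmin k le_rfl))
  set A : Finset κ := {i | c (some i) < k} with hA
  have hAk : #A = k := le_antisymm (heq ▸ hk) (hmin k le_rfl)
  have hkcard : k ≤ Fintype.card κ := hAk ▸ card_le_univ A
  have hmem (i : κ) : i ∈ A ↔ c (some i) < k := by simp [hA]
  have hmem' (i : κ) : i ∈ A ↔ c (some i) < k + 1 := by rw [heq]; simp
  have hsplit (j : ℕ) := card_lt_some (fun i => c (some i)) A j
  refine ⟨A, ?_, fun j hj => ?_, fun i hi => ?_, fun l hl => ?_⟩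
  · by_contra! h
    have := hc (k + 1) (by simpa using hkcard)
    rw [card_lt_option, if_neg (by omega)] at this
    omega
  · rw [Fintype.card_coe, hAk] at hj
    have h := hmin j hj
    rw [hsplit j] at h
    have : #{i : {i // i ∉ A} | c (some i) < j} = 0 := by
      rw [card_eq_zero, filter_eq_empty_iff]
      intro i _ hij
      exact i.2 ((hmem i).2 (hij.trans_le hj))
    beta_reduce
    omega
  · rw [hmem'] at hi
    omega
  · rw [card_subtype_notMem, hAk] at hl
    have h := hc (k + 1 + l) (by rw [Fintype.card_option]; omega)
    rw [card_lt_option, hsplit] at h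
    have h₁ : #{i : {i // i ∈ A} | c (some i) < k + 1 + l} ≤ k := by
      refine (card_le_univ _).trans ?_
      rw [Fintype.card_coe, hAk]
    have h₂ : #{i : {i // i ∉ A} | c (some i) < k + 1 + l} ≤
        #{i : {i // i ∉ A} | c (some i) - (#A + 1) < l} := by
      refine card_le_card fun i hi => ?_
      have := i.2
      rw [hmem'] at this
      simp only [mem_filter, mem_univ, true_and] at hi ⊢
      omega
    beta_reduce
    split_ifs at h <;> omega

lemma existsUnique_parkingSplits {c : Option κ → ℕ} (hc : IsParking c) :
    ∃! A, ParkingSplits c A := by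
  obtain ⟨A, hA⟩ := hc.exists_parkingSplits
  refine ⟨A, hA, fun B hB => Finset.ext fun i => ?_⟩
  rw [hA.mem_iff, hB.mem_iff, le_antisymm (hA.card_le hB) (hB.card_le hA)]

open scoped Classical in
lemma sum_parkingSplits [CommSemiring R] (A : Finset κ) (x : R) :
    ∑ c ∈ parkingSet (Option κ) with ParkingSplits c A, x ^ ∑ o, c o =
      (∑ k ∈ range (#A + 1), x ^ k) * (parkingEnum {i // i ∈ A} x *
        (x ^ ((Fintype.card κ - #A) * (#A + 1)) * parkingEnum {i // i ∉ A} x)) := by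
  rw [parkingEnum, parkingEnum, mul_sum, sum_mul_sum, ← sum_product', sum_mul_sum, ← sum_product']
  symm
  refine sum_bij (fun z _ => parkingGlue A z) ?_ ?_ ?_ ?_
  · rintro z hz
    simp only [mem_product, mem_range, mem_parkingSet] at hz
    have h : ParkingSplits (parkingGlue A z) A := by
      refine ⟨Nat.lt_succ_iff.1 hz.1, ?_, fun i hi => ?_, ?_⟩
      · simpa only [parkingGlue_mem] using hz.2.1
      · rw [parkingGlue_notMem A z ⟨i, hi⟩]
        omega
      · simpa only [parkingGlue_notMem, Nat.add_sub_cancel] using hz.2.2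
    exact mem_filter.2 ⟨mem_parkingSet.2 h.isParking, h⟩
  · rintro z - w - h
    refine Prod.ext (congrFun h none) (Prod.ext (funext fun i => ?_) (funext fun i => ?_))
    · simpa only [parkingGlue_mem] using congrFun h (some i)
    · simpa only [parkingGlue_notMem, Nat.add_right_cancel_iff] using congrFun h (some i)
  · intro c hc
    obtain ⟨h₀, h₁, h₂, h₃⟩ := (mem_filter.1 hc).2
    refine ⟨(c none, fun i => c (some i), fun i => c (some i) - (#A + 1)), ?_, ?_⟩
    · simp only [mem_product, mem_range, mem_parkingSet]
      exact ⟨Nat.lt_succ_iff.2 h₀, h₁, h₃⟩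
    · funext o
      rcases o with _ | i
      · rfl
      · by_cases hi : i ∈ A
        · simp [parkingGlue, hi]
        · have := h₂ i hi
          simp only [parkingGlue, hi, dite_false]
          omega
  · rintro z -
    rw [Fintype.sum_option, sum_eq_sum_mem_add_sum_notMem A]
    simp only [parkingGlue_mem, parkingGlue_notMem]
    rw [sum_add_distrib, sum_const, card_univ, card_subtype_notMem, smul_eq_mul, ← pow_add,
      ← pow_add, ← pow_add]
    congr 1
    simp only [parkingGlue]
    ring

lemma parkingEnum_succ [CommSemiring R] (n : ℕ) (x : R) :
    parkingEnum (Fin (n + 1)) x = ∑ i ∈ range (n + 1), n.choose i •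
      ((∑ k ∈ range (i + 1), x ^ k) * (parkingEnum (Fin i) x *
        (x ^ ((n - i) * (i + 1)) * parkingEnum (Fin (n - i)) x))) := by
  classical
  have hunique (c : Option (Fin n) → ℕ) (hc : c ∈ parkingSet (Option (Fin n))) :
      ∃! A, A ∈ (univ : Finset (Fin n)).powerset ∧ ParkingSplits c A := by
    simpa using existsUnique_parkingSplits (mem_parkingSet.1 hc)
  rw [← parkingEnum_eq_fin (ι := Option (Fin n)) (by simp), parkingEnum,
    sum_eq_sum_filter_of_existsUnique _ _ _ hunique]
  have hsum (A : Finset (Fin n)) : ∑ c ∈ parkingSet (Option (Fin n)) with ParkingSplits c A,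
      x ^ ∑ o, c o = (∑ k ∈ range (#A + 1), x ^ k) * (parkingEnum (Fin #A) x *
        (x ^ ((n - #A) * (#A + 1)) * parkingEnum (Fin (n - #A)) x)) := by
    rw [sum_parkingSplits, parkingEnum_eq_fin (Fintype.card_coe A),
      parkingEnum_eq_fin (card_subtype_notMem A), Fintype.card_fin]
  rw [sum_congr rfl fun A _ => hsum A, sum_powerset_apply_card (f := fun i =>
    (∑ k ∈ range (i + 1), x ^ k) * (parkingEnum (Fin i) x *
      (x ^ ((n - i) * (i + 1)) * parkingEnum (Fin (n - i)) x)))]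
  simp only [card_univ, Fintype.card_fin]

end Parking

lemma pow_mul_sum_inv_pow {R : Type*} [CommSemiring R] {x y : R} (hxy : x * y = 1) (i : ℕ) :
    x ^ i * ∑ k ∈ range (i + 1), y ^ k = ∑ k ∈ range (i + 1), x ^ k := by
  rw [← sum_range_reflect (fun k => x ^ k), mul_sum]
  refine sum_congr rfl fun k hk => ?_
  have hk : k ≤ i := Nat.lt_succ_iff.1 (mem_range.1 hk)
  obtain ⟨l, rfl⟩ := Nat.exists_eq_add_of_le hk
  rw [pow_add, mul_right_comm, ← mul_pow, hxy, one_pow, one_mul]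
  congr 1
  omega

/-- The sum enumerator of parking functions is the reversed inversion enumerator of forests. -/
lemma parkingEnum_eq_forestEnum {R : Type*} [CommSemiring R] {x y : R} (hxy : x * y = 1) (n : ℕ) :
    parkingEnum (Fin n) x = x ^ n.choose 2 * forestEnum (Fin n) y := by
  induction n using Nat.strong_induction_on with
  | _ n ih =>
    rcases n with _ | n
    · have hpark : parkingSet (Fin 0) = {default} := by
        ext c
        simp [mem_parkingSet, IsParking, Subsingleton.elim c default]
      simp [parkingEnum, forestEnum, forestInv, hpark, wellFounded_of_isEmpty]
    · rw [parkingEnum_succ, forestEnum_succ, mul_sum]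
      refine sum_congr rfl fun i hi => ?_
      have hi : i ≤ n := Nat.lt_succ_iff.1 (mem_range.1 hi)
      obtain ⟨j, rfl⟩ := Nat.exists_eq_add_of_le hi
      rw [mul_smul_comm, ih i (by omega), ih (i + j - i) (by omega), Nat.add_sub_cancel_left,
        ← pow_mul_sum_inv_pow hxy]
      have hchoose : (i + j + 1).choose 2 = i + i.choose 2 + j * (i + 1) + j.choose 2 := by
        have h (a b : ℕ) : (a + b).choose 2 = a.choose 2 + b.choose 2 + a * b := by
          induction b with
          | zero => simp
          | succ b ih =>
            rw [← add_assoc, Nat.choose_succ_succ' (a + b), ih, Nat.choose_succ_succ' b]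
            simp only [Nat.choose_one_right]
            ring
        rw [h, h]
        simp only [Nat.choose_succ_self]
        ring
      rw [hchoose, pow_add, pow_add, pow_add]
      congr 1
      ring

section Tree

open SimpleGraph

variable {n : ℕ}

/-- The vertex of `{0, ..., n}` that corresponds to the parent of an element of `Fin n`, where the
roots of the forest become children of the vertex `0`. -/
def vertex (o : Option (Fin n)) : Fin (n + 1) := o.elim 0 Fin.succ

/-- The graph obtained from the forest with parent function `p` by joining its roots to `0`. -/
def forestGraph (p : Fin n → Option (Fin n)) : SimpleGraph (Fin (n + 1)) :=
  SimpleGraph.fromRel fun u v => ∃ i : Fin n, u = i.succ ∧ v = vertex (p i)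

lemma exists_vertex_eq (v : Fin (n + 1)) : ∃ o : Option (Fin n), vertex o = v := by
  rcases Fin.eq_zero_or_eq_succ v with rfl | ⟨i, rfl⟩
  · exact ⟨none, rfl⟩
  · exact ⟨some i, rfl⟩

lemma vertex_none : vertex (none : Option (Fin n)) = 0 := rfl

lemma vertex_some (i : Fin n) : vertex (some i) = i.succ := rfl

lemma vertex_injective : Function.Injective (vertex (n := n)) := by
  intro a b h
  rcases a with _ | a <;> rcases b with _ | b
  · rfl
  · exact absurd h.symm (Fin.succ_ne_zero b)
  · exact absurd h (Fin.succ_ne_zero a)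
  · exact congrArg some (Fin.succ_injective n h)

variable {p : Fin n → Option (Fin n)}

lemma not_transGen_self (hp : WellFounded (IsParent p)) (i : Fin n) :
    ¬ TransGen (IsParent p) i i :=
  fun h => hp.transGen.asymmetric i i h h

lemma forestGraph_adj (hp : WellFounded (IsParent p)) (i : Fin n) :
    (forestGraph p).Adj i.succ (vertex (p i)) := by
  refine (SimpleGraph.fromRel_adj _ _ _).2 ⟨fun h => ?_, Or.inl ⟨i, rfl, rfl⟩⟩
  have : p i = some i := vertex_injective h.symm
  exact not_transGen_self hp i (.single this)

lemma exists_path_forestGraph (hp : WellFounded (IsParent p)) (i : Fin n) :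
    ∃ w : (forestGraph p).Walk i.succ 0, w.IsPath ∧ w.snd = vertex (p i) ∧
      ∀ j : Fin n, j.succ ∈ w.support ↔ ReflTransGen (IsParent p) j i := by
  induction i using hp.induction with
  | _ i ih =>
    have hadj := forestGraph_adj hp i
    rcases hi : p i with _ | k
    · rw [hi, vertex_none] at hadj
      refine ⟨.cons hadj .nil, ?_, by simp [vertex_none], fun j => ?_⟩
      · simp [Walk.cons_isPath_iff]
      · have hroot : ReflTransGen (IsParent p) j i ↔ i = j := by
          refine reflTransGen_iff_eq_or_transGen.trans (or_iff_left fun h => ?_)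
          obtain ⟨c, -, hc⟩ := TransGen.tail'_iff.1 h
          rw [IsParent, hi] at hc
          cases hc
        rw [hroot]
        simp [eq_comm]
    · rw [hi, vertex_some] at hadj
      obtain ⟨w, hw, -, hsupp⟩ := ih k hi
      refine ⟨.cons hadj w, ?_, by simp [vertex_some], fun j => ?_⟩
      · rw [Walk.cons_isPath_iff, hsupp]
        exact ⟨hw, fun h => not_transGen_self hp i (TransGen.tail' h hi)⟩
      · rw [Walk.support_cons, List.mem_cons, hsupp, Fin.succ_inj,
          reflTransGen_iff_eq_or_transGen (b := i), TransGen.tail'_iff, eq_comm]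
        refine or_congr_right ⟨fun h => ⟨k, h, hi⟩, ?_⟩
        rintro ⟨c, hc, hci⟩
        cases hci.symm.trans hi
        exact hc

lemma forestGraph_connected (hp : WellFounded (IsParent p)) : (forestGraph p).Connected := by
  have hreach (v : Fin (n + 1)) : (forestGraph p).Reachable v 0 := by
    rcases Fin.eq_zero_or_eq_succ v with rfl | ⟨i, rfl⟩
    · rfl
    · obtain ⟨w, -⟩ := exists_path_forestGraph hp i
      exact ⟨w⟩
  exact (connected_iff _).2 ⟨fun u v => (hreach u).trans (hreach v).symm, ⟨0⟩⟩

lemma forestGraph_isTree (hp : WellFounded (IsParent p)) : (forestGraph p).IsTree := by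
  have hconn := forestGraph_connected hp
  refine isTree_iff_connected_and_card.2 ⟨hconn, le_antisymm ?_ ?_⟩
  · have hsub : (forestGraph p).edgeSet ⊆ Set.range fun i : Fin n => s(i.succ, vertex (p i)) := by
      intro e
      induction e with
      | _ u v =>
        rw [mem_edgeSet, forestGraph, SimpleGraph.fromRel_adj]
        rintro ⟨-, ⟨i, rfl, rfl⟩ | ⟨i, rfl, rfl⟩⟩
        · exact ⟨i, rfl⟩
        · exact ⟨i, Sym2.eq_swap⟩
    have := (Nat.card_mono (Set.toFinite _) hsub).trans (Finite.card_range_le _)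
    simp only [Nat.card_eq_fintype_card, Fintype.card_fin] at this ⊢
    omega
  · exact hconn.card_vert_le_card_edgeSet_add_one

lemma treeInv_forestGraph (hp : WellFounded (IsParent p)) :
    treeInv (forestGraph p) = forestInv p := by
  classical
  have hiff (i j : Fin n) : (∀ w : (forestGraph p).Walk i.succ 0, w.IsPath → j.succ ∈ w.support) ↔
      ReflTransGen (IsParent p) j i := by
    obtain ⟨w, hw, -, hsupp⟩ := exists_path_forestGraph hp i
    rw [← hsupp]
    refine ⟨fun h => h w hw, fun h w' hw' => ?_⟩
    rwa [((forestGraph_isTree hp).existsUnique_path _ _).unique hw' hw]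
  have hne (i j : Fin n) (hij : i < j) : ReflTransGen (IsParent p) j i ↔
      TransGen (IsParent p) j i :=
    reflTransGen_iff_eq_or_transGen.trans (or_iff_right hij.ne)
  rw [treeInv, Nat.card_eq_fintype_card, Fintype.card_subtype, card_filter, Fintype.sum_prod_type,
    Fin.sum_univ_succ]
  simp only [lt_irrefl, false_and, if_false, sum_const_zero, zero_add, Fin.succ_pos, true_and]
  rw [forestInv]
  refine sum_congr rfl fun i _ => ?_
  rw [Fin.sum_univ_succ, card_filter]
  simp only [Fin.not_lt_zero, false_and, if_false, zero_add, Fin.succ_lt_succ_iff, hiff]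
  refine sum_congr rfl fun j _ => ?_
  refine if_congr (and_congr_right fun hij => hne i j hij) rfl rfl

lemma snd_eq_of_isPath (hp : WellFounded (IsParent p)) (i : Fin n)
    (w : (forestGraph p).Walk i.succ 0) (hw : w.IsPath) : w.snd = vertex (p i) := by
  obtain ⟨w', hw', hsnd, -⟩ := exists_path_forestGraph hp i
  rw [((forestGraph_isTree hp).existsUnique_path _ _).unique hw hw', hsnd]

lemma forestGraph_injective {q : Fin n → Option (Fin n)} (hp : WellFounded (IsParent p))
    (hq : WellFounded (IsParent q)) (h : forestGraph p = forestGraph q) : p = q := by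
  funext i
  obtain ⟨w, hw, hsnd, -⟩ := exists_path_forestGraph hp i
  have hq := snd_eq_of_isPath hq i
  rw [← h] at hq
  exact vertex_injective (hsnd.symm.trans (hq w hw))

lemma exists_forestGraph_eq {G : SimpleGraph (Fin (n + 1))} (hG : G.IsTree) :
    ∃ p : Fin n → Option (Fin n), WellFounded (IsParent p) ∧ forestGraph p = G := by
  choose w hw huniq using fun v => hG.existsUnique_path v 0
  choose p hp using fun i : Fin n => exists_vertex_eq (w i.succ).snd
  have hnil (i : Fin n) : ¬ (w i.succ).Nil := fun h => Fin.succ_ne_zero i h.eq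
  have hwf : WellFounded (IsParent p) := by
    refine Subrelation.wf (fun {a b} hab => ?_) (measure fun i : Fin n => (w i.succ).length).wf
    have hsnd : a.succ = (w b.succ).snd := by rw [← hp b, hab]; rfl
    have htail := huniq _ _ (hw b.succ).tail
    have hlen := Walk.length_tail_add_one (hnil b)
    change (w a.succ).length < (w b.succ).length
    rw [htail] at hlen
    rw [hsnd]
    omega
  have hle : forestGraph p ≤ G := by
    intro u v huv
    rw [forestGraph, SimpleGraph.fromRel_adj] at huv
    have hadj (i : Fin n) : G.Adj i.succ (vertex (p i)) := hp i ▸ (w i.succ).adj_snd (hnil i)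
    rcases huv.2 with ⟨i, rfl, rfl⟩ | ⟨i, rfl, rfl⟩
    · exact hadj i
    · exact (hadj i).symm
  exact ⟨p, hwf, le_antisymm hle
    ((isTree_iff_minimal_connected.1 hG).le_of_le (forestGraph_connected hwf) hle)⟩

end Tree

lemma isParkingFunction_iff {n : ℕ} (c : Fin n → ℕ) :
    IsParkingFunction (fun i => c i + 1) ↔ IsParking c := by
  simp only [IsParkingFunction, Nat.le_add_left, implies_true, true_and, Nat.add_le_add_iff_right]
  constructor
  · rintro ⟨σ, -, h⟩ k hk
    rw [Fintype.card_fin] at hk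
    calc k = #{i : Fin n | (i : ℕ) < k} := by
          simp [Fin.card_filter_val_lt, hk]
      _ = #(({i : Fin n | (i : ℕ) < k} : Finset _).map σ.toEmbedding) := (card_map _).symm
      _ ≤ #{i | c i < k} := by
        refine card_le_card fun i hi => ?_
        obtain ⟨j, hj, rfl⟩ := mem_map.1 hi
        simp only [mem_filter, mem_univ, true_and] at hj ⊢
        exact (h j).trans_lt hj
  · intro h
    have hmono := Tuple.monotone_sort c
    refine ⟨Tuple.sort c, fun i j hij => Nat.succ_le_succ (hmono hij), fun i => ?_⟩
    by_contra! hlt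
    have hi := h (i + 1) (by simp)
    have hle : #{j | c j < i + 1} ≤ i := by
      calc #{j | c j < i + 1} ≤ #(({j | j < i} : Finset (Fin n)).map
              (Tuple.sort c).toEmbedding) := by
            refine card_le_card fun j hj => mem_map.2 ⟨(Tuple.sort c).symm j, ?_, by simp⟩
            simp only [mem_filter, mem_univ, true_and] at hj ⊢
            by_contra! hij
            have := hmono hij
            simp only [Function.comp_apply, Equiv.apply_symm_apply] at this
            omega
        _ = i := by rw [card_map, filter_gt_eq_Iio, Fin.card_Iio]
    omega

open LaurentPolynomial in
lemma finsum_parkingFunction (n : ℕ) :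
    (∑ᶠ a : {a : Fin n → ℕ // IsParkingFunction a}, (T ((∑ i, a.1 i : ℕ) : ℤ) : ℤ[T;T⁻¹])) =
      T 1 ^ n * parkingEnum (Fin n) (T 1) := by
  let e (c : {c // c ∈ parkingSet (Fin n)}) : {a : Fin n → ℕ // IsParkingFunction a} :=
    ⟨fun i => c.1 i + 1, (isParkingFunction_iff c.1).2 (mem_parkingSet.1 c.2)⟩
  have he : Function.Bijective e := by
    constructor
    · intro c d h
      ext i
      simpa [e] using congrFun (congrArg Subtype.val h) i
    · rintro ⟨a, ha⟩
      have hsub : (fun i => a i - 1 + 1) = a := funext fun i => Nat.sub_add_cancel (ha.1 i)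
      refine ⟨⟨fun i => a i - 1, mem_parkingSet.2 ((isParkingFunction_iff _).1 ?_)⟩,
        Subtype.ext hsub⟩
      rwa [hsub]
  rw [← finsum_eq_of_bijective (f := fun c : {c // c ∈ parkingSet (Fin n)} =>
    (T 1 ^ n * T 1 ^ ∑ i, c.1 i : ℤ[T;T⁻¹])) e he]
  · rw [finsum_eq_sum_of_fintype, parkingEnum, mul_sum]
    exact sum_coe_sort (parkingSet (Fin n)) fun c => (T 1 ^ n * T 1 ^ ∑ i, c i : ℤ[T;T⁻¹])
  · intro c
    simp only [e, sum_add_distrib, T_pow, ← T_add]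
    congr 1
    simp [add_comm]

open LaurentPolynomial in
lemma finsum_tree (n : ℕ) :
    (∑ᶠ G : {G : SimpleGraph (Fin (n + 1)) // G.IsTree}, (T (-(treeInv G.1 : ℤ)) : ℤ[T;T⁻¹])) =
      forestEnum (Fin n) (T (-1)) := by
  classical
  let e (p : {p : Fin n → Option (Fin n) // WellFounded (IsParent p)}) :
      {G : SimpleGraph (Fin (n + 1)) // G.IsTree} := ⟨forestGraph p.1, forestGraph_isTree p.2⟩
  have he : Function.Bijective e := by
    constructor
    · intro p q h
      exact Subtype.ext (forestGraph_injective p.2 q.2 (congrArg Subtype.val h))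
    · rintro ⟨G, hG⟩
      obtain ⟨p, hp, rfl⟩ := exists_forestGraph_eq hG
      exact ⟨⟨p, hp⟩, rfl⟩
  rw [← finsum_eq_of_bijective (f := fun p : {p : Fin n → Option (Fin n) //
    WellFounded (IsParent p)} => (T (-1) ^ forestInv p.1 : ℤ[T;T⁻¹])) e he]
  · rw [finsum_eq_sum_of_fintype, forestEnum]
    exact (sum_subtype _ (by simp) fun p => (T (-1) ^ forestInv p : ℤ[T;T⁻¹])).symm
  · intro p
    simp [e, treeInv_forestGraph p.2]

end ParkingTree

open scoped Classical in
/-- `P_n(x) = x^(C(n+1,2)) * I_{n+1}(1/x)`: the parking function sum enumerator equals the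
reversed inversion enumerator of labeled trees on `n + 1` vertices (as Laurent polynomials). -/
theorem pf_tree_identity (n : ℕ) :
    (∑ᶠ a : {a : Fin n → ℕ // IsParkingFunction a},
        (LaurentPolynomial.T ((∑ i, a.1 i : ℕ) : ℤ) : LaurentPolynomial ℤ)) =
      LaurentPolynomial.T (((n + 1).choose 2 : ℕ) : ℤ) *
        ∑ᶠ T : {G : SimpleGraph (Fin (n + 1)) // G.IsTree},
          (LaurentPolynomial.T (-(treeInv T.1 : ℤ)) : LaurentPolynomial ℤ) := by
  have hinv : (LaurentPolynomial.T 1 * LaurentPolynomial.T (-1) : LaurentPolynomial ℤ) = 1 := by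
    rw [← LaurentPolynomial.T_add, add_neg_cancel, LaurentPolynomial.T_zero]
  rw [ParkingTree.finsum_parkingFunction, ParkingTree.finsum_tree,
    ParkingTree.parkingEnum_eq_forestEnum hinv, ← mul_assoc, ← pow_add,
    Nat.choose_succ_succ' n 1, Nat.choose_one_right, LaurentPolynomial.T_pow, mul_one]
end

section
/- The inversion enumerator of labeled trees equals a specialization of the Tutte polynomial of the complete graph: I_n(y) = T_{M(K_n)}(1, y). -/
open scoped Classical in
/-- The rank, in the graphic matroid, of a finite set `S` of edges:
the largest cardinality of an acyclic subset of `S`. -/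
noncomputable def graphRank {V : Type} [Fintype V] (S : Finset (Sym2 V)) : ℕ :=
  (S.powerset.filter fun A : Finset (Sym2 V) =>
    (SimpleGraph.fromEdgeSet (↑A : Set (Sym2 V))).IsAcyclic).sup Finset.card

open scoped Classical in
/-- The Tutte polynomial of the graphic matroid `M(G)` of a graph `G`:
`T(x, y) = Σ_{S ⊆ E} (x-1)^(r(E) - r(S)) * (y-1)^(|S| - r(S))`. -/
noncomputable def graphTutte {V : Type} [Fintype V] (G : SimpleGraph V) :
    MvPolynomial (Fin 2) ℤ :=
  ∑ S ∈ G.edgeFinset.powerset,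
    (MvPolynomial.X 0 - 1) ^ (graphRank G.edgeFinset - graphRank S) *
      (MvPolynomial.X 1 - 1) ^ (S.card - graphRank S)

theorem List.lt_cases_prefix {α : Type*} [LinearOrder α] {l m : List α} (h : l < m) :
    l <+: m ∨ ∃ c x y s t, l = c ++ x :: s ∧ m = c ++ y :: t ∧ x < y := by
  induction l generalizing m with
  | nil => exact Or.inl (List.nil_prefix)
  | cons a l ih =>
    cases m with
    | nil => simp at h
    | cons b m =>
      rcases List.cons_lt_cons_iff.1 h with h | ⟨rfl, hlm⟩
      · exact Or.inr ⟨[], a, b, l, m, rfl, rfl, h⟩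
      · rcases ih hlm with hp | ⟨c, x, y, s, t, rfl, rfl, hxy⟩
        · exact Or.inl (by simpa using hp)
        · exact Or.inr ⟨a :: c, x, y, s, t, rfl, rfl, hxy⟩

theorem List.append_cons_lt_append_cons {α : Type*} [LinearOrder α] (c : List α) {x y : α}
    (s t : List α) (h : x < y) : c ++ x :: s < c ++ y :: t :=
  List.append_left_lt (List.cons_lt_cons_iff.2 (Or.inl h))

theorem List.IsChain.exists_nodup {α : Type*} {R : α → α → Prop} {l : List α} (h : l.IsChain R) :
    ∃ l' : List α, l'.Nodup ∧ l'.IsChain R ∧ l' ⊆ l ∧ l'.head? = l.head? ∧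
      l'.getLast? = l.getLast? := by
  classical
  induction l with
  | nil => exact ⟨[], by simp⟩
  | cons a t ih =>
    obtain ⟨t', hn, hc, hs, hh, hl⟩ := ih h.tail
    by_cases ha : a ∈ t'
    · obtain ⟨p, q, rfl⟩ := List.append_of_mem ha
      refine ⟨a :: q, ?_, ?_, ?_, ?_, ?_⟩ <;> grind [List.isChain_append]
    · refine ⟨a :: t', ?_, ?_, ?_, ?_, ?_⟩ <;> grind [List.isChain_cons]

namespace SimpleGraph

variable {V : Type*}

/-- `G.IsListPath r v l` says that `l` lists the successive vertices of a path of `G`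
from `r` to `v`. -/
structure IsListPath (G : SimpleGraph V) (r v : V) (l : List V) : Prop where
  nodup : l.Nodup
  isChain : l.IsChain G.Adj
  head : l.head? = some r
  getLast : l.getLast? = some v

namespace IsListPath

variable {G H : SimpleGraph V} {r u v w : V} {l m : List V}

theorem mono (hGH : G ≤ H) (h : G.IsListPath r v l) : H.IsListPath r v l :=
  ⟨h.nodup, h.isChain.imp fun _ _ hab => hGH hab, h.head, h.getLast⟩

theorem mem_end (h : G.IsListPath r v l) : v ∈ l :=
  List.mem_of_getLast? h.getLast

theorem of_append_cons (h : G.IsListPath r v (l ++ w :: m)) : G.IsListPath r w (l ++ [w]) := by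
  obtain ⟨h1, h2, h3, h4⟩ := h
  refine ⟨?_, ?_, ?_, ?_⟩ <;> grind [List.isChain_append]

theorem concat (h : G.IsListPath r v l) (hw : w ∉ l) (hvw : G.Adj v w) :
    G.IsListPath r w (l ++ [w]) := by
  obtain ⟨h1, h2, h3, h4⟩ := h
  refine ⟨?_, ?_, ?_, ?_⟩ <;> grind [List.isChain_append]

theorem eq_of_prefix (hl : G.IsListPath r v l) (hm : H.IsListPath r v m) (h : l <+: m) :
    l = m := by
  obtain ⟨t, rfl⟩ := h
  by_contra hne
  have ht : t ≠ [] := by simpa using hne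
  have hlast := hm.getLast
  rw [List.getLast?_append_of_ne_nil _ ht] at hlast
  exact (List.disjoint_of_nodup_append hm.nodup) hl.mem_end (List.mem_of_getLast? hlast)

theorem exists_walk (h : G.IsListPath r v l) : ∃ p : G.Walk r v, p.IsPath ∧ p.support = l := by
  obtain ⟨h1, h2, h3, h4⟩ := h
  have hne : l ≠ [] := by rintro rfl; simp at h3
  have hr : l.head hne = r := by simpa [List.head?_eq_some_head hne] using h3
  have hv : l.getLast hne = v := by grind
  refine ⟨(Walk.ofSupport l hne h2).copy hr hv, ?_, ?_⟩
  · simpa [Walk.isPath_def] using h1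
  · simp

end IsListPath

theorem Walk.IsPath.isListPath {G : SimpleGraph V} {r v : V} {p : G.Walk r v} (hp : p.IsPath) :
    G.IsListPath r v p.support :=
  ⟨hp.support_nodup, p.isChain_adj_support, by cases p <;> simp, by
    rw [List.getLast?_eq_some_getLast p.support_ne_nil, p.getLast_support]⟩

section LinearOrder

variable [LinearOrder V]

open scoped Classical in
/-- The lexicographically largest path of `G` from `r` to `v`, as a list of vertices: the path
followed by the depth-first search from `r` that prefers large neighbours. -/
noncomputable def dfsPath (G : SimpleGraph V) (r v : V) : List V :=
  if h : ∃ l, G.IsListPath r v l ∧ ∀ m, G.IsListPath r v m → m ≤ l then h.choose else []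

variable {G H : SimpleGraph V} {r u v w : V} {l m : List V}

/-- The depth-first search tree of `G` from `r` that prefers large neighbours. -/
def dfsTree (G : SimpleGraph V) (r : V) : SimpleGraph V where
  Adj u v := u ≠ v ∧ (G.dfsPath r v = G.dfsPath r u ++ [v] ∨ G.dfsPath r u = G.dfsPath r v ++ [u])
  symm := ⟨fun _ _ h => ⟨h.1.symm, h.2.symm⟩⟩
  loopless := ⟨fun _ h => h.1 rfl⟩

theorem dfsTree_adj : (G.dfsTree r).Adj u v ↔
    G.dfsPath r v = G.dfsPath r u ++ [v] ∨ G.dfsPath r u = G.dfsPath r v ++ [u] := by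
  refine ⟨fun h => h.2, fun h => ⟨?_, h⟩⟩
  rintro rfl
  simp at h

/-- `G.IsBackEdge r u i`: the vertex `u` is an ancestor of `i` in the depth-first search tree
of `G`, and the child of `u` towards `i` is larger than `i`. -/
def IsBackEdge (G : SimpleGraph V) (r u i : V) : Prop :=
  ∃ j, i < j ∧ G.dfsPath r j = G.dfsPath r u ++ [j] ∧ G.dfsPath r j <+: G.dfsPath r i

theorem IsBackEdge.length_lt (h : G.IsBackEdge r u v) :
    (G.dfsPath r u).length < (G.dfsPath r v).length := by
  obtain ⟨j, -, h1, h2⟩ := h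
  simpa [h1] using h2.length_le

theorem IsBackEdge.not_adj_dfsTree (h : G.IsBackEdge r u v) : ¬ (G.dfsTree r).Adj u v := by
  rw [dfsTree_adj]
  rintro (h1 | h1)
  · obtain ⟨j, hj, h2, h3⟩ := h
    have h4 := h3.eq_of_length (by simp [h1, h2])
    rw [h1, h2] at h4
    exact hj.ne' (by simpa using h4)
  · simpa [h1] using h.length_lt

/-- The set of all edges that can be added to `G` without changing its depth-first search tree. -/
def backEdgeSet (G : SimpleGraph V) (r : V) : Set (Sym2 V) :=
  {e | ∃ u i, G.IsBackEdge r u i ∧ e = s(u, i)}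

theorem mk_mem_backEdgeSet :
    s(u, v) ∈ G.backEdgeSet r ↔ G.IsBackEdge r u v ∨ G.IsBackEdge r v u := by
  constructor
  · rintro ⟨a, i, h, he⟩
    rcases Sym2.eq_iff.1 he with ⟨rfl, rfl⟩ | ⟨rfl, rfl⟩
    · exact Or.inl h
    · exact Or.inr h
  · rintro (h | h)
    · exact ⟨u, v, h, rfl⟩
    · exact ⟨v, u, h, Sym2.eq_swap⟩

theorem not_isDiag_of_mem_backEdgeSet {e : Sym2 V} (he : e ∈ G.backEdgeSet r) : ¬ e.IsDiag := by
  obtain ⟨u, i, h, rfl⟩ := he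
  intro hui
  obtain rfl : u = i := hui
  exact lt_irrefl _ h.length_lt

variable [Finite V]

theorem Connected.dfsPath_spec (hG : G.Connected) (r v : V) :
    G.IsListPath r v (G.dfsPath r v) ∧ ∀ m, G.IsListPath r v m → m ≤ G.dfsPath r v := by
  have h : ∃ l, G.IsListPath r v l ∧ ∀ m, G.IsListPath r v m → m ≤ l := by
    have := Fintype.ofFinite V
    have hfin : {l | G.IsListPath r v l}.Finite :=
      (Set.finite_coe_iff.1 (Finite.of_fintype {l : List V // l.Nodup})).subset fun l hl => hl.nodup
    obtain ⟨p, hp⟩ := hG.exists_isPath r v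
    obtain ⟨l, hl, hmax⟩ := hfin.exists_maximal ⟨_, hp.isListPath⟩
    exact ⟨l, hl, fun m hm => (le_total m l).elim id fun h => hmax hm h⟩
  unfold dfsPath
  rw [dif_pos h]
  exact h.choose_spec

theorem Connected.isListPath_dfsPath (hG : G.Connected) (r v : V) :
    G.IsListPath r v (G.dfsPath r v) :=
  (hG.dfsPath_spec r v).1

theorem IsListPath.le_dfsPath (h : G.IsListPath r v l) (hG : G.Connected) :
    l ≤ G.dfsPath r v :=
  (hG.dfsPath_spec r v).2 l h

theorem Connected.dfsPath_self (hG : G.Connected) (r : V) : G.dfsPath r r = [r] := by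
  obtain ⟨h1, h2, h3, h4⟩ := hG.isListPath_dfsPath r r
  generalize G.dfsPath r r = l at *
  cases l with
  | nil => simp at h3
  | cons a t =>
    rcases List.eq_nil_or_concat t with rfl | ⟨s, b, rfl⟩
    · simpa using h3
    · grind

theorem Connected.dfsPath_injective (hG : G.Connected) (r : V) :
    Function.Injective (G.dfsPath r) := by
  intro u v h
  have h1 := (hG.isListPath_dfsPath r u).getLast
  rw [h, (hG.isListPath_dfsPath r v).getLast] at h1
  simpa using h1.symm

/-- Every initial segment of a lexicographically largest path is itself lexicographically
largest. -/
theorem Connected.dfsPath_eq_of_append_cons (hG : G.Connected)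
    (h : G.dfsPath r v = l ++ w :: m) : G.dfsPath r w = l ++ [w] := by
  have hv := hG.isListPath_dfsPath r v
  rw [h] at hv
  have hlw := hv.of_append_cons
  have hw := hG.isListPath_dfsPath r w
  by_contra hne
  rcases List.lt_cases_prefix (lt_of_le_of_ne (hlw.le_dfsPath hG) (Ne.symm hne)) with
    hp | ⟨c, x, y, s, t, hl, hy, hxy⟩
  · exact hne (hlw.eq_of_prefix hw hp).symm
  rw [hy] at hw
  have hvl : l ++ w :: m = c ++ x :: (s ++ m) := by
    rw [← List.singleton_append, ← List.append_assoc, hl]; simp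
  have hchain : (y :: t ++ m).IsChain G.Adj := by
    obtain ⟨h1, h2, h3, h4⟩ := hw
    obtain ⟨h5, h6, h7, h8⟩ := hv
    grind [List.isChain_append]
  obtain ⟨q, hq1, hq2, hq3, hq4, hq5⟩ := hchain.exists_nodup
  have hq : G.IsListPath r v (c ++ q) := by
    obtain ⟨h1, h2, h3, h4⟩ := hw
    obtain ⟨h5, h6, h7, h8⟩ := hv
    refine ⟨?_, ?_, ?_, ?_⟩
    · rw [hvl] at h5
      rw [List.nodup_append] at h1 h5 ⊢
      refine ⟨h1.1, hq1, fun a ha b hb => ?_⟩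
      have := hq3 hb
      grind
    · rw [List.isChain_append] at h2 ⊢
      refine ⟨h2.1, hq2, ?_⟩
      rw [hq4]
      simpa using h2.2.2
    · rw [List.head?_append] at h3 ⊢
      rw [hq4]
      simpa using h3
    · rw [List.getLast?_append, hq5]
      grind
  have hle := hq.le_dfsPath hG
  rw [h, hvl] at hle
  obtain ⟨q', rfl⟩ : ∃ q', q = y :: q' := by
    cases q with
    | nil => simp at hq4
    | cons a q' => exact ⟨q', by simpa using hq4⟩
  exact absurd (List.append_cons_lt_append_cons c (s ++ m) q' hxy) (not_lt.2 hle)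

theorem Connected.mem_dfsPath_iff (hG : G.Connected) :
    w ∈ G.dfsPath r v ↔ G.dfsPath r w <+: G.dfsPath r v := by
  refine ⟨fun h => ?_, fun h => h.subset (hG.isListPath_dfsPath r w).mem_end⟩
  obtain ⟨l, m, hlm⟩ := List.append_of_mem h
  rw [hG.dfsPath_eq_of_append_cons hlm, hlm]
  exact ⟨m, by simp⟩

theorem Connected.exists_dfsPath_eq_concat (hG : G.Connected) (hv : v ≠ r) :
    ∃ u, G.dfsPath r v = G.dfsPath r u ++ [v] := by
  have h := hG.isListPath_dfsPath r v
  rcases List.eq_nil_or_concat (G.dfsPath r v) with h0 | ⟨l, a, h0⟩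
  · simp [h0] at *
    simpa using h.head
  obtain rfl : a = v := by simpa [h0] using h.getLast
  rcases List.eq_nil_or_concat l with rfl | ⟨l, u, rfl⟩
  · exact absurd (by simpa [h0] using h.head) hv
  · refine ⟨u, ?_⟩
    rw [hG.dfsPath_eq_of_append_cons (l := l) (w := u) (m := [a]) (by simpa using h0)]
    simpa using h0

theorem Connected.adj_of_dfsPath_eq_concat (hG : G.Connected)
    (h : G.dfsPath r v = G.dfsPath r u ++ [v]) : G.Adj u v := by
  have h1 := (hG.isListPath_dfsPath r v).isChain
  rw [h, List.isChain_append] at h1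
  exact h1.2.2 _ (hG.isListPath_dfsPath r u).getLast _ (by simp)

theorem Connected.dfsTree_le (hG : G.Connected) (r : V) : G.dfsTree r ≤ G := by
  intro u v h
  rcases h.2 with h | h
  · exact hG.adj_of_dfsPath_eq_concat h
  · exact (hG.adj_of_dfsPath_eq_concat h).symm

theorem Connected.isListPath_dfsTree (hG : G.Connected) (r v : V) :
    (G.dfsTree r).IsListPath r v (G.dfsPath r v) := by
  have h := hG.isListPath_dfsPath r v
  refine ⟨h.nodup, ?_, h.head, h.getLast⟩
  rw [List.isChain_iff_forall_rel_of_append_cons_cons]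
  intro a b l m hlm
  refine dfsTree_adj.2 (Or.inl ?_)
  rw [hG.dfsPath_eq_of_append_cons hlm,
    hG.dfsPath_eq_of_append_cons (l := l ++ [a]) (w := b) (m := m) (by simpa using hlm)]

theorem Connected.connected_dfsTree (hG : G.Connected) (r : V) : (G.dfsTree r).Connected := by
  have := hG.nonempty
  refine Connected.mk fun u v => ?_
  obtain ⟨p, -⟩ := (hG.isListPath_dfsTree r u).exists_walk
  obtain ⟨q, -⟩ := (hG.isListPath_dfsTree r v).exists_walk
  exact (p.reverse.append q).reachable

theorem Connected.isTree_dfsTree (hG : G.Connected) (r : V) : (G.dfsTree r).IsTree := by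
  classical
  have hc := hG.connected_dfsTree r
  refine isTree_iff_connected_and_card.2 ⟨hc, le_antisymm ?_ hc.card_vert_le_card_edgeSet_add_one⟩
  have := Fintype.ofFinite V
  choose f hf using fun v : {v // v ≠ r} => hG.exists_dfsPath_eq_concat v.2
  have hsub : (G.dfsTree r).edgeSet ⊆ Set.range fun v : {v // v ≠ r} => s(f v, v.1) := by
    have key : ∀ u v, G.dfsPath r v = G.dfsPath r u ++ [v] →
        ∃ w : {v // v ≠ r}, s(f w, w.1) = s(u, v) := by
      intro u v h
      have hv : v ≠ r := by
        rintro rfl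
        rw [hG.dfsPath_self] at h
        have h1 := (hG.isListPath_dfsPath v u).mem_end
        have h2 : G.dfsPath v u = [] := by
          have := congrArg List.length h
          simpa using this
        simp [h2] at h1
      refine ⟨⟨v, hv⟩, ?_⟩
      have h1 := hf ⟨v, hv⟩
      rw [h] at h1
      rw [hG.dfsPath_injective r (List.append_cancel_right h1)]
    intro e
    induction e with
    | h u v =>
      intro h
      rcases dfsTree_adj.1 h with h | h
      · exact key u v h
      · rw [Sym2.eq_swap]
        exact key v u h
  have h1 := (Set.ncard_le_ncard hsub).trans (Finite.card_range_le _)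
  have h2 : Nat.card {v // v ≠ r} + 1 = Nat.card V := by
    simp [Nat.card_eq_fintype_card, Fintype.card_subtype_compl]
    have := Fintype.card_pos_iff.2 ⟨r⟩
    omega
  rw [Set.ncard] at h1
  rw [← h2]
  exact Nat.succ_le_succ h1

theorem IsTree.dfsTree_eq (hG : G.IsTree) (r : V) : G.dfsTree r = G :=
  le_antisymm (hG.connected.dfsTree_le r)
    ((isTree_iff_minimal_connected.1 hG).2 (hG.connected.connected_dfsTree r)
      (hG.connected.dfsTree_le r))

theorem Connected.dfsPath_dfsTree (hG : G.Connected) (r v : V) :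
    (G.dfsTree r).dfsPath r v = G.dfsPath r v :=
  le_antisymm
    ((((hG.connected_dfsTree r).isListPath_dfsPath r v).mono (hG.dfsTree_le r)).le_dfsPath hG)
    ((hG.isListPath_dfsTree r v).le_dfsPath (hG.connected_dfsTree r))

theorem Connected.adj_dfsTree_or_isBackEdge (hG : G.Connected) (h : G.Adj u v) :
    (G.dfsTree r).Adj u v ∨ G.IsBackEdge r u v ∨ G.IsBackEdge r v u := by
  have key : ∀ {u v}, G.Adj u v → u ∈ G.dfsPath r v →
      (G.dfsTree r).Adj u v ∨ G.IsBackEdge r u v := by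
    intro u v h hu
    have hv : v ∉ G.dfsPath r u := fun hv => h.ne <| hG.dfsPath_injective r <|
      (hG.mem_dfsPath_iff.1 hu).eq_of_length_le (hG.mem_dfsPath_iff.1 hv).length_le
    obtain ⟨t, ht⟩ := hG.mem_dfsPath_iff.1 hu
    have hle := ((hG.isListPath_dfsPath r u).concat hv h).le_dfsPath hG
    cases t with
    | nil => exact absurd (hG.dfsPath_injective r (by simpa using ht)) h.ne
    | cons j t =>
      have hj := hG.dfsPath_eq_of_append_cons ht.symm
      rcases lt_trichotomy v j with hvj | rfl | hvj
      · exact Or.inr ⟨j, hvj, hj, t, by rw [hj, ← ht]; simp⟩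
      · exact Or.inl (dfsTree_adj.2 (Or.inl hj))
      · rw [← ht] at hle
        exact absurd (List.append_cons_lt_append_cons _ t [] hvj) (not_lt.2 hle)
  by_cases hu : u ∈ G.dfsPath r v
  · exact (key h hu).imp_right Or.inl
  by_cases hv : v ∈ G.dfsPath r u
  · exact (key h.symm hv).imp (fun h => h.symm) Or.inr
  · have h1 := ((hG.isListPath_dfsPath r u).concat hv h).le_dfsPath hG
    have h2 := ((hG.isListPath_dfsPath r v).concat hu h.symm).le_dfsPath hG
    have h3 : ∀ (l : List V) (a : V), l < l ++ [a] := fun l a => by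
      simpa using List.append_left_lt (l₁ := l) (List.nil_lt_cons a [])
    exact absurd ((h3 _ _).trans_le (h1.trans ((h3 _ _).le.trans h2))) (lt_irrefl _)

/-- Adding back edges to `H` does not change its lexicographically largest paths. -/
theorem Connected.dfsPath_eq_of_le (hH : H.Connected) (hle : H ≤ G)
    (hG : ∀ u v, G.Adj u v → (H.dfsTree r).Adj u v ∨ H.IsBackEdge r u v ∨ H.IsBackEdge r v u)
    (v : V) : G.dfsPath r v = H.dfsPath r v := by
  have hGc : G.Connected := hH.mono hle
  have hQ := hH.isListPath_dfsPath r v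
  have hP := hGc.isListPath_dfsPath r v
  by_contra hne
  rcases List.lt_cases_prefix
      (lt_of_le_of_ne ((hQ.mono hle).le_dfsPath hGc) (Ne.symm hne)) with
    hp | ⟨c, j, k, s, t, hj, hk, hjk⟩
  · exact hne (hQ.eq_of_prefix hP hp).symm
  -- Adjacent vertices of `G` are comparable in the tree.
  have hcomp : ∀ u v, G.Adj u v →
      H.dfsPath r u <+: H.dfsPath r v ∨ H.dfsPath r v <+: H.dfsPath r u := by
    intro u v h
    rcases hG u v h with h | ⟨j, -, h1, h2⟩ | ⟨j, -, h1, h2⟩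
    · rcases dfsTree_adj.1 h with h | h
      · exact Or.inl ⟨_, h.symm⟩
      · exact Or.inr ⟨_, h.symm⟩
    · exact Or.inl ((List.prefix_append _ _).trans (h1 ▸ h2))
    · exact Or.inr ((List.prefix_append _ _).trans (h1 ▸ h2))
  have hdesc : ∀ x ∈ k :: t, c ++ [j] <+: H.dfsPath r x := by
    have hchain : (k :: t).IsChain fun y x => G.Adj y x ∧ y ∉ c := by
      have h1 := hP.isChain
      have h2 := hP.nodup
      rw [hk] at h1 h2
      refine (List.isChain_append.1 h1).2.1.imp_of_mem_imp fun a b ha _ hab => ⟨hab, fun hac => ?_⟩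
      exact List.disjoint_of_nodup_append h2 hac ha
    refine hchain.backwards_induction (fun x => c ++ [j] <+: H.dfsPath r x) _ ?_ ?_
    · rintro y x ⟨hyx, hyc⟩ hx
      rcases hcomp y x hyx with h | h
      · rcases List.prefix_or_prefix_of_prefix h hx with h | h
        · rcases List.prefix_concat_iff.1 h with h | h
          · exact h ▸ List.prefix_rfl
          · exact absurd (h.subset (hH.isListPath_dfsPath r y).mem_end) hyc
        · exact h
      · exact hx.trans h
    · intro hne'
      have h1 := hP.getLast
      rw [hk, List.getLast?_append_of_ne_nil _ hne', List.getLast?_eq_some_getLast hne'] at h1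
      rw [Option.some.inj h1, hj]
      exact ⟨s, by simp⟩
  have hkD := hdesc k List.mem_cons_self
  rcases List.eq_nil_or_concat c with rfl | ⟨c', u, hc⟩
  · have h1 := hQ.head
    have h2 := hP.head
    rw [hj] at h1
    rw [hk] at h2
    simp only [List.nil_append, List.head?_cons, Option.some.injEq] at h1 h2
    exact hjk.ne (h1.trans h2.symm)
  rw [List.concat_eq_append] at hc
  have hu : H.dfsPath r u = c := by
    rw [hc]
    exact hH.dfsPath_eq_of_append_cons (m := j :: s) (by rw [hj, hc]; simp)
  have huk : G.Adj u k := by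
    have h1 := hP.isChain
    rw [hk, List.isChain_append] at h1
    exact h1.2.2 u (by simp [hc]) k (by simp)
  have hlen : c.length < (H.dfsPath r k).length := by simpa using hkD.length_le
  have hchild : ∀ i, c ++ [i] <+: H.dfsPath r k → i = j := by
    intro i hi
    have := (List.prefix_of_prefix_length_le hi hkD (by simp)).eq_of_length (by simp)
    simpa using this
  rcases hG u k huk with h | ⟨i, hki, h1, h2⟩ | ⟨i, -, h1, h2⟩
  · rcases dfsTree_adj.1 h with h | h
    · rw [hu] at h
      exact hjk.ne' (hchild k (h ▸ List.prefix_rfl))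
    · rw [hu] at h
      simp [h] at hlen
  · rw [h1, hu] at h2
    exact absurd (hchild i h2 ▸ hki) hjk.not_gt
  · have := h2.length_le
    rw [h1, hu] at this
    simp at this
    omega

/-- The connected graphs with depth-first search tree `T` are exactly those obtained from `T`
by adding back edges. -/
theorem IsTree.dfsTree_eq_iff {T : SimpleGraph V} (hT : T.IsTree) (hG : G.Connected) :
    G.dfsTree r = T ↔ T ≤ G ∧
      ∀ u v, G.Adj u v → T.Adj u v ∨ T.IsBackEdge r u v ∨ T.IsBackEdge r v u := by
  constructor
  · rintro rfl
    refine ⟨hG.dfsTree_le r, fun u v h => ?_⟩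
    have := hG.adj_dfsTree_or_isBackEdge (r := r) h
    simpa only [IsBackEdge, hG.dfsPath_dfsTree] using this
  · rintro ⟨hle, h⟩
    have hP : G.dfsPath r = T.dfsPath r := funext <| hT.connected.dfsPath_eq_of_le hle
      (by rwa [hT.dfsTree_eq])
    conv_rhs => rw [← hT.dfsTree_eq r]
    simp only [dfsTree, hP]

theorem IsTree.mem_dfsPath_iff {T : SimpleGraph V} (hT : T.IsTree) :
    u ∈ T.dfsPath r v ↔ ∀ p : T.Walk v r, p.IsPath → u ∈ p.support := by
  obtain ⟨q, hq, hqs⟩ := (hT.connected.isListPath_dfsPath r v).exists_walk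
  have key : ∀ p : T.Walk v r, p.IsPath → p = q.reverse := fun p hp =>
    (hT.existsUnique_path v r).unique hp hq.reverse
  rw [← hqs]
  refine ⟨fun h p hp => by simpa [key p hp] using h, fun h => ?_⟩
  simpa using h q.reverse hq.reverse

theorem IsTree.disjoint_edgeSet_backEdgeSet {T : SimpleGraph V} (hT : T.IsTree) (r : V) :
    Disjoint T.edgeSet (T.backEdgeSet r) := by
  rw [Set.disjoint_right]
  rintro _ ⟨u, i, h, rfl⟩ hadj
  refine h.not_adj_dfsTree ?_
  rwa [hT.dfsTree_eq]

/-- The edge sets of the connected graphs with depth-first search tree `T` form the interval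
from `T.edgeSet` to `T.edgeSet ∪ T.backEdgeSet r`. -/
theorem IsTree.dfsTree_fromEdgeSet_eq_iff {T : SimpleGraph V} (hT : T.IsTree) {S : Set (Sym2 V)} :
    ((∀ e ∈ S, ¬ e.IsDiag) ∧ (fromEdgeSet S).Connected) ∧ (fromEdgeSet S).dfsTree r = T ↔
      T.edgeSet ⊆ S ∧ S ⊆ T.edgeSet ∪ T.backEdgeSet r := by
  constructor
  · rintro ⟨⟨hS, hc⟩, h⟩
    obtain ⟨h1, h2⟩ := (hT.dfsTree_eq_iff hc).1 h
    constructor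
    · intro e he
      have := edgeSet_mono h1 he
      rw [edgeSet_fromEdgeSet] at this
      exact this.1
    · intro e he
      induction e with
      | h u v =>
        rw [Set.mem_union, mk_mem_backEdgeSet]
        exact h2 u v ((fromEdgeSet_adj S).2 ⟨he, hS _ he⟩)
  · rintro ⟨h1, h2⟩
    have hS : ∀ e ∈ S, ¬ e.IsDiag := fun e he => (h2 he).elim
      (fun h => T.not_isDiag_of_mem_edgeSet h) not_isDiag_of_mem_backEdgeSet
    have hle : T ≤ fromEdgeSet S := fun u v h => (fromEdgeSet_adj S).2 ⟨h1 h, h.ne⟩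
    have hc : (fromEdgeSet S).Connected := hT.connected.mono hle
    refine ⟨⟨hS, hc⟩, (hT.dfsTree_eq_iff hc).2 ⟨hle, fun u v h => ?_⟩⟩
    have := h2 ((fromEdgeSet_adj S).1 h).1
    rwa [Set.mem_union, mk_mem_backEdgeSet] at this

end LinearOrder

theorem IsTree.ncard_backEdgeSet {n : ℕ} {T : SimpleGraph (Fin (n + 1))} (hT : T.IsTree) :
    (T.backEdgeSet 0).ncard = treeInv T := by
  have hc := hT.connected
  choose f hf using fun v : {v : Fin (n + 1) // v ≠ 0} => hc.exists_dfsPath_eq_concat v.2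
  unfold treeInv
  simp_rw [← hT.mem_dfsPath_iff]
  symm
  have hne : ∀ {i j : Fin (n + 1)}, i < j → j ≠ 0 := fun h => Fin.ne_zero_of_lt h
  have hback : ∀ (i j : Fin (n + 1)) (hij : i < j), j ∈ T.dfsPath 0 i →
      T.IsBackEdge 0 (f ⟨j, hne hij⟩) i := fun i j hij hj =>
    ⟨j, hij, hf ⟨j, hne hij⟩, hc.mem_dfsPath_iff.1 hj⟩
  refine Nat.card_eq_of_bijective (β := T.backEdgeSet 0)
    (fun p => ⟨s(f ⟨p.1.2, hne p.2.2.1⟩, p.1.1), _, _, hback _ _ p.2.2.1 p.2.2.2, rfl⟩)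
    ⟨?_, ?_⟩
  · rintro ⟨⟨i, j⟩, h0, hij, hj⟩ ⟨⟨i', j'⟩, h0', hij', hj'⟩ h
    rcases Sym2.eq_iff.1 (Subtype.ext_iff.1 h) with ⟨h1, h2⟩ | ⟨h1, h2⟩
    · dsimp only at h1 h2 hij hj hij' hj'
      subst h2
      have h3 := hf ⟨j, hne hij⟩
      have h4 := hf ⟨j', hne hij'⟩
      have h5 := (List.prefix_of_prefix_length_le (hc.mem_dfsPath_iff.1 hj)
        (hc.mem_dfsPath_iff.1 hj') (by rw [h3, h4, h1]; simp)).eq_of_length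
          (by rw [h3, h4, h1]; simp)
      exact Subtype.ext (Prod.ext rfl (hc.dfsPath_injective 0 h5))
    · have h3 := (hback i j hij hj).length_lt
      have h4 := (hback i' j' hij' hj').length_lt
      dsimp only at h1 h2
      rw [h1] at h3
      rw [← h2] at h4
      exact absurd h3 h4.not_gt
  · rintro ⟨_, u, i, ⟨j, hij, h1, h2⟩, rfl⟩
    have hi : i ≠ 0 := by
      rintro rfl
      have := hc.mem_dfsPath_iff.2 h2
      rw [hc.dfsPath_self] at this
      exact hne hij (by simpa using this)
    refine ⟨⟨(i, j), Fin.pos_of_ne_zero hi, hij, hc.mem_dfsPath_iff.2 h2⟩, ?_⟩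
    have h3 := hf ⟨j, hne hij⟩
    rw [h1] at h3
    simp only [hc.dfsPath_injective 0 (List.append_cancel_right h3)]

end SimpleGraph

theorem exists_isTree_of_isAcyclic_fromEdgeSet {V : Type*} [Nonempty V] {A : Finset (Sym2 V)}
    (hA : ∀ e ∈ A, ¬ e.IsDiag) (h : (SimpleGraph.fromEdgeSet (A : Set (Sym2 V))).IsAcyclic) :
    ∃ T : SimpleGraph V, T.IsTree ∧ (A : Set (Sym2 V)) ⊆ T.edgeSet := by
  obtain ⟨T, hAT, -, hT⟩ :=
    SimpleGraph.connected_top.exists_isTree_le_of_le_of_isAcyclic le_top h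
  refine ⟨T, hT, fun e he => SimpleGraph.edgeSet_mono hAT ?_⟩
  rw [SimpleGraph.edgeSet_fromEdgeSet]
  exact ⟨he, hA e he⟩

section GraphRank

variable {V : Type} [Fintype V]

theorem card_le_graphRank {A S : Finset (Sym2 V)} (hAS : A ⊆ S)
    (hA : (SimpleGraph.fromEdgeSet (A : Set (Sym2 V))).IsAcyclic) : A.card ≤ graphRank S := by
  classical
  exact Finset.le_sup (f := Finset.card) (Finset.mem_filter.2 ⟨Finset.mem_powerset.2 hAS, hA⟩)

theorem exists_card_eq_graphRank (S : Finset (Sym2 V)) :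
    ∃ A ⊆ S, (SimpleGraph.fromEdgeSet (A : Set (Sym2 V))).IsAcyclic ∧ A.card = graphRank S := by
  classical
  obtain ⟨A, hA, h⟩ := Finset.exists_mem_eq_sup (S.powerset.filter fun A : Finset (Sym2 V) =>
    (SimpleGraph.fromEdgeSet (↑A : Set (Sym2 V))).IsAcyclic) ⟨∅, by simp⟩ Finset.card
  rw [Finset.mem_filter, Finset.mem_powerset] at hA
  refine ⟨A, hA.1, hA.2, ?_⟩
  rw [← h]
  unfold graphRank
  congr!

theorem SimpleGraph.IsTree.ncard_edgeSet_add_one {T : SimpleGraph V} (hT : T.IsTree) :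
    T.edgeSet.ncard + 1 = Fintype.card V := by
  rw [← Nat.card_eq_fintype_card]
  exact (SimpleGraph.isTree_iff_connected_and_card.1 hT).2

theorem graphRank_add_one_le [Nonempty V] {S : Finset (Sym2 V)} (hS : ∀ e ∈ S, ¬ e.IsDiag) :
    graphRank S + 1 ≤ Fintype.card V := by
  obtain ⟨A, hAS, hA, hcard⟩ := exists_card_eq_graphRank S
  obtain ⟨T, hT, hAT⟩ := exists_isTree_of_isAcyclic_fromEdgeSet (fun e he => hS e (hAS he)) hA
  have := Set.ncard_le_ncard hAT
  rw [Set.ncard_coe_finset, hcard] at this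
  have := hT.ncard_edgeSet_add_one
  omega

/-- A set of edges spans a connected graph exactly if it has the largest possible rank. -/
theorem graphRank_add_one_eq_iff [Nonempty V] {S : Finset (Sym2 V)} (hS : ∀ e ∈ S, ¬ e.IsDiag) :
    graphRank S + 1 = Fintype.card V ↔
      (SimpleGraph.fromEdgeSet (S : Set (Sym2 V))).Connected := by
  constructor
  · intro h
    obtain ⟨A, hAS, hA, hcard⟩ := exists_card_eq_graphRank S
    obtain ⟨T, hT, hAT⟩ := exists_isTree_of_isAcyclic_fromEdgeSet (fun e he => hS e (hAS he)) hA
    have hT1 := hT.ncard_edgeSet_add_one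
    have hTA : (A : Set (Sym2 V)) = T.edgeSet :=
      Set.eq_of_subset_of_ncard_le hAT (by rw [Set.ncard_coe_finset]; omega)
    refine hT.connected.mono fun u v huv => (SimpleGraph.fromEdgeSet_adj _).2 ⟨?_, huv.ne⟩
    refine hAS (?_ : s(u, v) ∈ (A : Set (Sym2 V)))
    rwa [hTA]
  · intro h
    classical
    obtain ⟨T, hTS, hT⟩ := h.exists_isTree_le
    have h1 : T.edgeFinset ⊆ S := fun e he => by
      have := SimpleGraph.edgeSet_mono hTS (SimpleGraph.mem_edgeFinset.1 he)
      rw [SimpleGraph.edgeSet_fromEdgeSet] at this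
      exact this.1
    have h2 := card_le_graphRank h1 (by simpa using hT.isAcyclic)
    have h3 := hT.card_edgeFinset
    have h4 := graphRank_add_one_le hS
    omega

open scoped Classical in
/-- At `x = 1`, the Tutte polynomial of a connected graph enumerates its connected spanning
subgraphs. -/
theorem aeval_one_graphTutte {R : Type*} [CommRing R] [Algebra ℤ R] {G : SimpleGraph V}
    (hG : G.Connected) (y : R) :
    MvPolynomial.aeval ![(1 : R), y] (graphTutte G) =
      ∑ S ∈ G.edgeFinset.powerset with
        (SimpleGraph.fromEdgeSet ((S : Finset (Sym2 V)) : Set (Sym2 V))).Connected,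
        (y - 1) ^ (S.card + 1 - Fintype.card V) := by
  have := hG.nonempty
  have hdiag : ∀ {S : Finset (Sym2 V)}, S ⊆ G.edgeFinset → ∀ e ∈ S, ¬ e.IsDiag := fun hS e he =>
    G.not_isDiag_of_mem_edgeSet (SimpleGraph.mem_edgeFinset.1 (hS he))
  have hE := (graphRank_add_one_eq_iff (hdiag subset_rfl)).2 (by simpa using hG)
  rw [graphTutte, map_sum, Finset.sum_filter]
  refine Finset.sum_congr rfl fun S hS => ?_
  have hS' := hdiag (Finset.mem_powerset.1 hS)
  have hle := graphRank_add_one_le hS'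
  simp only [map_mul, map_pow, map_sub, map_one, MvPolynomial.aeval_X, Matrix.cons_val_zero,
    Matrix.cons_val_one, sub_self]
  split_ifs with h
  · have h1 := (graphRank_add_one_eq_iff hS').2 h
    rw [show graphRank G.edgeFinset - graphRank S = 0 by omega, pow_zero, one_mul]
    congr 1
    omega
  · have h1 := mt (graphRank_add_one_eq_iff hS').1 h
    rw [zero_pow (by omega), zero_mul]

end GraphRank

theorem Finset.sum_Icc_pow_card_sub {α R : Type*} [DecidableEq α] [CommRing R] (y : R)
    {s t : Finset α} (h : Disjoint s t) :
    ∑ u ∈ Finset.Icc s (s ∪ t), (y - 1) ^ (u.card - s.card) = y ^ t.card := by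
  rw [Finset.Icc_eq_image_powerset Finset.subset_union_left, Finset.union_sdiff_cancel_left h,
    Finset.sum_image]
  · have := Finset.sum_pow_mul_eq_add_pow (y - 1) 1 t
    simp only [one_pow, mul_one, sub_add_cancel] at this
    rw [← this]
    refine Finset.sum_congr rfl fun u hu => ?_
    rw [Finset.card_union_of_disjoint (h.mono_right (Finset.mem_powerset.1 hu)),
      Nat.add_sub_cancel_left]
  · intro u hu v hv huv
    have hu' := h.mono_right (Finset.mem_powerset.1 hu)
    have hv' := h.mono_right (Finset.mem_powerset.1 hv)
    rw [← Finset.union_sdiff_cancel_left hu', ← Finset.union_sdiff_cancel_left hv']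
    exact congrArg (· \ s) huv

/-- The inversion enumerator of labeled trees on `n + 1` vertices is the specialization
`T_{M(K_{n+1})}(1, y)` of the Tutte polynomial of the complete graph. -/
theorem invPoly_eq_tutte (n : ℕ) :
    MvPolynomial.aeval ![(1 : Polynomial ℤ), Polynomial.X]
        (graphTutte (⊤ : SimpleGraph (Fin (n + 1)))) = invPoly n := by
  classical
  rw [aeval_one_graphTutte (G := ⊤) SimpleGraph.connected_top, invPoly, finsum_eq_sum_of_fintype,
    ← Finset.sum_subtype (Finset.univ.filter fun T : SimpleGraph (Fin (n + 1)) => T.IsTree)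
      (by simp) fun T => (Polynomial.X : Polynomial ℤ) ^ treeInv T]
  rw [← Finset.sum_fiberwise_of_maps_to
    (g := fun S : Finset (Sym2 (Fin (n + 1))) =>
      (SimpleGraph.fromEdgeSet (S : Set (Sym2 (Fin (n + 1))))).dfsTree 0)
    (t := Finset.univ.filter fun T : SimpleGraph (Fin (n + 1)) => T.IsTree)]
  · refine Finset.sum_congr rfl fun T hT => ?_
    replace hT : T.IsTree := by simpa using hT
    have hdisj : Disjoint T.edgeFinset (T.backEdgeSet 0).toFinset := by
      rw [SimpleGraph.edgeFinset, Set.disjoint_toFinset]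
      exact hT.disjoint_edgeSet_backEdgeSet 0
    rw [← hT.ncard_backEdgeSet, Set.ncard_eq_toFinset_card',
      ← Finset.sum_Icc_pow_card_sub Polynomial.X hdisj]
    refine Finset.sum_congr ?_ fun S _ => ?_
    · ext S
      have := hT.dfsTree_fromEdgeSet_eq_iff (r := 0) (S := (S : Set (Sym2 (Fin (n + 1)))))
      simp only [Finset.mem_filter, Finset.mem_powerset, Finset.mem_Icc,
        ← Finset.coe_subset, Finset.coe_union, SimpleGraph.coe_edgeFinset, Set.coe_toFinset,
        SimpleGraph.edgeSet_top]
      exact this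
    · have := hT.card_edgeFinset
      congr 1
      omega
  · intro S hS
    rw [@Finset.mem_filter _ _ (_) _ _] at hS
    exact Finset.mem_filter.2 ⟨Finset.mem_univ _, hS.2.isTree_dfsTree 0⟩
end
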